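/- arXiv:1810.09024 — 3 statements merged into one kernel-verified Lean document; each statement's English description precedes it below -/
import Mathlib

section
/- Let n, d ≥ 1 and let X₁, …, X_d, Y₁, …, Y_d ∈ M_n(ℝ). The following are equivalent: (1) there exists an orthogonal matrix O ∈ M_n(ℝ) (i.e. O·Oᵀ = I_n) such that O·X_i·Oᵀ = Y_i for all i; (2) for every word w in the 2d letters x₁,…,x_d,x₁ᵗ,…,x_dᵗ, tr(w(X₁,…,X_d,X₁ᵀ,…,X_dᵀ)) = tr(w(Y₁,…,Y_d,Y₁ᵀ,…,Y_dᵀ)); (3) the same trace equality holds for all such words of length at most n². -/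
open Matrix

namespace SpechtAux

/-- Span of the words of length at most `k`. -/
def wordSpan {ι P : Type*} [Ring P] [Algebra ℝ P] (z : ι → P) (k : ℕ) : Submodule ℝ P :=
  Submodule.span ℝ {p | ∃ l : List ι, l.length ≤ k ∧ (l.map z).prod = p}

section growth
variable {ι P : Type*} [Ring P] [Algebra ℝ P] (z : ι → P)

lemma word_mem {k : ℕ} (l : List ι) (h : l.length ≤ k) : (l.map z).prod ∈ wordSpan z k :=
  Submodule.subset_span ⟨l, h, rfl⟩

lemma wordSpan_mono {i j : ℕ} (h : i ≤ j) : wordSpan z i ≤ wordSpan z j := by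
  apply Submodule.span_mono
  rintro p ⟨l, hl, rfl⟩
  exact ⟨l, hl.trans h, rfl⟩

lemma mul_mem_wordSpan {i j : ℕ} {a b : P} (ha : a ∈ wordSpan z i) (hb : b ∈ wordSpan z j) :
    a * b ∈ wordSpan z (i + j) := by
  have h : a * b ∈ wordSpan z i * wordSpan z j := Submodule.mul_mem_mul ha hb
  unfold wordSpan at h
  rw [Submodule.span_mul_span] at h
  refine Submodule.span_mono ?_ h
  rintro _ ⟨_, ⟨l, hl, rfl⟩, _, ⟨l', hl', rfl⟩, rfl⟩
  exact ⟨l ++ l', by simp; omega, by simp⟩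

lemma letter_mem (a : ι) : z a ∈ wordSpan z 1 := by
  simpa using word_mem z (k := 1) [a] (by simp)

lemma letter_pow_mem (a : ι) (j : ℕ) : z a ^ j ∈ wordSpan z j := by
  have := word_mem z (k := j) (List.replicate j a) (by simp)
  simpa using this

lemma stab {k : ℕ} (h : wordSpan z (k + 1) ≤ wordSpan z k) (l : List ι) :
    (l.map z).prod ∈ wordSpan z k := by
  induction l with
  | nil => exact word_mem z [] (by simp)
  | cons a l ih =>
    apply h
    rw [List.map_cons, List.prod_cons, add_comm]
    exact mul_mem_wordSpan z (letter_mem z a) ih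

lemma tail_step {k : ℕ} (u : P) (hu : u ∈ wordSpan z k) (a : ι)
    (h : wordSpan z (k + 1) ≤ wordSpan z k ⊔ Submodule.span ℝ {u * z a}) (j : ℕ) :
    wordSpan z (k + j + 1) ≤ wordSpan z (k + j) ⊔ Submodule.span ℝ {u * z a ^ (j + 1)} := by
  induction j with
  | zero => simpa using h
  | succ j ih =>
    unfold wordSpan
    rw [Submodule.span_le]
    rintro _ ⟨l, hl, rfl⟩
    cases l with
    | nil => exact Submodule.mem_sup_left (word_mem z [] (by simp))
    | cons b l =>
      have h1 : (l.map z).prod ∈ wordSpan z (k + j + 1) := word_mem z l (by simp at hl; omega)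
      obtain ⟨v, hv, v', hv', e⟩ := Submodule.mem_sup.1 (ih h1)
      obtain ⟨c, rfl⟩ := Submodule.mem_span_singleton.1 hv'
      have h2 : z b * u ∈ wordSpan z (k + 1) := by
        rw [add_comm]; exact mul_mem_wordSpan z (letter_mem z b) hu
      obtain ⟨t, ht, t', ht', e'⟩ := Submodule.mem_sup.1 (h h2)
      obtain ⟨c', rfl⟩ := Submodule.mem_span_singleton.1 ht'
      have h3 : (List.map z (b :: l)).prod
          = (z b * v + c • (t * z a ^ (j + 1))) + (c * c') • (u * z a ^ (j + 1 + 1)) := by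
        have e2 : z b * (u * z a ^ (j + 1)) = t * z a ^ (j + 1) + c' • (u * z a ^ (j + 1 + 1)) := by
          rw [← mul_assoc, ← e', add_mul, smul_mul_assoc, mul_assoc u, ← pow_succ' (z a)]
        rw [List.map_cons, List.prod_cons, ← e, mul_add, mul_smul_comm, e2, smul_add, smul_smul,
          add_assoc (z b * v)]
      change (List.map z (b :: l)).prod ∈ _
      rw [h3]
      refine Submodule.add_mem_sup (Submodule.add_mem _ ?_ (Submodule.smul_mem _ _ ?_))
        (Submodule.smul_mem _ _ (Submodule.mem_span_singleton_self _))
      · have := mul_mem_wordSpan z (letter_mem z b) hv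
        exact wordSpan_mono z (by omega) this
      · have := mul_mem_wordSpan z ht (letter_pow_mem z a (j + 1))
        exact wordSpan_mono z (by omega) this

lemma tail_stab {k m : ℕ} (hm : 0 < m) (u : P) (hu : u ∈ wordSpan z k) (a : ι)
    (h : wordSpan z (k + 1) ≤ wordSpan z k ⊔ Submodule.span ℝ {u * z a})
    (f : Polynomial ℝ) (hf : f.Monic) (hfm : f.natDegree = m)
    (hfa : Polynomial.aeval (z a) f = 0) (l : List ι) :
    (l.map z).prod ∈ wordSpan z (k + (m - 1)) := by
  apply stab
  refine (tail_step z u hu a h (m - 1)).trans ?_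
  refine sup_le le_rfl ?_
  rw [Submodule.span_le, Set.singleton_subset_iff]
  have hm1 : m - 1 + 1 = m := by omega
  rw [hm1]
  rw [Polynomial.aeval_eq_sum_range, Finset.sum_range_succ, hf.coeff_natDegree, one_smul,
    hfm] at hfa
  have e : z a ^ m = - ∑ x ∈ Finset.range m, f.coeff x • z a ^ x := by
    rw [eq_neg_iff_add_eq_zero, add_comm]; exact hfa
  rw [e, mul_neg, Finset.mul_sum]
  refine Submodule.neg_mem _ (Submodule.sum_mem _ fun i hi => ?_)
  rw [mul_smul_comm]
  refine Submodule.smul_mem _ _ ?_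
  have := mul_mem_wordSpan z hu (letter_pow_mem z a i)
  exact wordSpan_mono z (by simp at hi; omega) this

lemma trace_words [FiniteDimensional ℝ P] [Nontrivial P] (τ : P →ₗ[ℝ] ℝ)
    (hnd : ∀ a, (∀ b, τ (a * b) = 0) → a = 0) (N m : ℕ)
    (hdim : Module.finrank ℝ P ≤ 2 * N) (hm : 0 < m) (hmN : 2 * m ≤ N + 4)
    (hf : ∀ a, ∃ f : Polynomial ℝ, f.Monic ∧ f.natDegree = m ∧ Polynomial.aeval (z a) f = 0)
    (hτ : ∀ l : List ι, l.length ≤ N → τ (l.map z).prod = 0) (l : List ι) :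
    τ (l.map z).prod = 0 := by
  classical
  have hτV : ∀ v ∈ wordSpan z N, τ v = 0 := by
    intro v hv
    have : wordSpan z N ≤ LinearMap.ker τ := by
      unfold wordSpan
      rw [Submodule.span_le]
      rintro _ ⟨l, hl, rfl⟩
      exact hτ l hl
    exact this hv
  have hex : ∃ k, Module.finrank ℝ (wordSpan z (k + 1)) ≤ Module.finrank ℝ (wordSpan z k) + 1 := by
    by_contra! hcon
    have : ∀ k, k ≤ Module.finrank ℝ (wordSpan z k) := by
      intro k
      induction k with
      | zero => simp
      | succ k ih => have := hcon k; omega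
    have h1 := this (Module.finrank ℝ P + 1)
    have h2 := Submodule.finrank_le (wordSpan z (Module.finrank ℝ P + 1))
    omega
  set k := Nat.find hex with hk
  have hks := Nat.find_spec hex
  rw [← hk] at hks
  have hgrow : ∀ j ≤ k, 2 * j + 1 ≤ Module.finrank ℝ (wordSpan z j) := by
    intro j hj
    induction j with
    | zero =>
      have h1 : (1 : P) ∈ wordSpan z 0 := by simpa using word_mem z (k := 0) [] (by simp)
      have : wordSpan z 0 ≠ ⊥ := by
        intro h0
        rw [h0] at h1
        exact one_ne_zero ((Submodule.mem_bot ℝ).1 h1)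
      have := Submodule.one_le_finrank_iff.2 this
      omega
    | succ j ih =>
      have h1 := ih (by omega)
      have h2 := Nat.find_min hex (m := j) (by omega)
      omega
  -- all words lie in `wordSpan z (k + (m-1))`
  have hall : ∀ l : List ι, (l.map z).prod ∈ wordSpan z (k + (m - 1)) := by
    by_cases hst : wordSpan z (k + 1) ≤ wordSpan z k
    · intro l
      exact wordSpan_mono z (by omega) (stab z hst l)
    · have : ∃ w : List ι, w.length ≤ k + 1 ∧ (w.map z).prod ∉ wordSpan z k := by
        by_contra! hcon
        apply hst
        conv_lhs => unfold wordSpan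
        rw [Submodule.span_le]
        rintro _ ⟨l, hl, rfl⟩
        exact hcon l hl
      obtain ⟨w, hw, hwV⟩ := this
      rcases List.eq_nil_or_concat w with rfl | ⟨u, a, rfl⟩
      · exact absurd (word_mem z [] (by simp)) hwV
      · obtain ⟨f, hf1, hf2, hf3⟩ := hf a
        have hul : u.length ≤ k := by simp at hw; omega
        have hwe : ((u.concat a).map z).prod = (u.map z).prod * z a := by simp
        have hwm : ((u.concat a).map z).prod ∈ wordSpan z (k + 1) := word_mem z _ hw
        rw [hwe] at hwV hwm
        refine tail_stab z hm (u.map z).prod (word_mem z u hul) a ?_ f hf1 hf2 hf3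
        have hle : wordSpan z k ⊔ Submodule.span ℝ {(u.map z).prod * z a} ≤ wordSpan z (k + 1) := by
          refine sup_le (wordSpan_mono z (by omega)) ?_
          rw [Submodule.span_le, Set.singleton_subset_iff]
          exact hwm
        have hlt : wordSpan z k < wordSpan z k ⊔ Submodule.span ℝ {(u.map z).prod * z a} := by
          refine lt_of_le_of_ne le_sup_left ?_
          intro heq
          apply hwV
          rw [heq]
          exact Submodule.mem_sup_right (Submodule.mem_span_singleton_self _)
        have := Submodule.finrank_lt_finrank_of_lt hlt
        exact (Submodule.eq_of_le_of_finrank_le hle (by omega)).ge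
  by_cases hkN : k + (m - 1) ≤ N
  · exact hτV _ (wordSpan_mono z hkN (hall l))
  · exfalso
    by_cases hkN' : N < k
    · have h1 := hgrow k le_rfl
      have h2 := Submodule.finrank_le (wordSpan z k)
      omega
    · have h1 := hgrow k le_rfl
      have h2 := hgrow (N - k) (by omega)
      let B : LinearMap.BilinForm ℝ P := (LinearMap.mul ℝ P).compr₂ τ
      have hB : ∀ a b, B a b = τ (a * b) := fun a b => rfl
      have hker : LinearMap.ker B = ⊥ := by
        rw [eq_bot_iff]
        intro a ha
        rw [LinearMap.mem_ker] at ha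
        refine (Submodule.mem_bot ℝ).2 (hnd a fun b => ?_)
        rw [← hB, ha]; rfl
      have h3 := LinearMap.BilinForm.finrank_add_finrank_orthogonal' (B := B) (wordSpan z k)
      rw [hker, inf_bot_eq, finrank_bot, add_zero] at h3
      have h4 : wordSpan z (N - k) ≤ B.orthogonal (wordSpan z k) := by
        intro b hb a ha
        change B a b = 0
        rw [hB]
        apply hτV
        exact wordSpan_mono z (by omega) (mul_mem_wordSpan z ha hb)
      have h5 := Submodule.finrank_mono h4
      omega

end growth
end SpechtAux

namespace SpechtAux

lemma eq_zero_of_trace_sq {n : ℕ} {A : Matrix (Fin n) (Fin n) ℝ} (h : (Aᵀ * A).trace = 0) :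
    A = 0 := by
  have := trace_conjTranspose_mul_self_eq_zero_iff (A := A)
  rw [conjTranspose_eq_transpose_of_trivial] at this
  exact this.1 h

/-- The Frobenius bilinear form. -/
noncomputable def frob (n : ℕ) : LinearMap.BilinForm ℝ (Matrix (Fin n) (Fin n) ℝ) :=
  LinearMap.mk₂ ℝ (fun a b => (aᵀ * b).trace)
    (by intros; simp [add_mul]) (by intros; simp) (by intros; simp [mul_add]) (by intros; simp)

lemma frob_apply {n : ℕ} (a b : Matrix (Fin n) (Fin n) ℝ) : frob n a b = (aᵀ * b).trace := rfl

lemma frob_refl (n : ℕ) : (frob n).IsRefl := by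
  intro a b h
  rw [frob_apply] at h ⊢
  rw [← trace_transpose, transpose_mul, transpose_transpose]; exact h

section inter
variable {ι : Type*} {n : ℕ} (x y : ι → Matrix (Fin n) (Fin n) ℝ)
  (p q : Matrix (Fin n) (Fin n) ℝ)

/-- The algebra (with unit `(p, q)`) spanned by the pairs of compressed words. -/
def pairAlg : Submodule ℝ (Matrix (Fin n) (Fin n) ℝ × Matrix (Fin n) (Fin n) ℝ) :=
  Submodule.span ℝ {c | ∃ l : List ι, c = ((l.map x).prod * p, (l.map y).prod * q)}

lemma word_commute {x : ι → Matrix (Fin n) (Fin n) ℝ} {p : Matrix (Fin n) (Fin n) ℝ}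
    (h : ∀ a, x a * p = p * x a) (l : List ι) : (l.map x).prod * p = p * (l.map x).prod := by
  induction l with
  | nil => simp
  | cons a l ih => rw [List.map_cons, List.prod_cons, mul_assoc, ih, ← mul_assoc, h, mul_assoc]

lemma word_transpose (hs : ∀ a, ∃ b, x b = (x a)ᵀ ∧ y b = (y a)ᵀ) (l : List ι) :
    ∃ l' : List ι, (l'.map x).prod = ((l.map x).prod)ᵀ ∧ (l'.map y).prod = ((l.map y).prod)ᵀ := by
  induction l with
  | nil => exact ⟨[], by simp⟩
  | cons a l ih =>
    obtain ⟨l', h1, h2⟩ := ih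
    obtain ⟨b, hb1, hb2⟩ := hs a
    exact ⟨l' ++ [b], by simp [h1, hb1], by simp [h2, hb2]⟩

lemma exists_intertwiner
    (hs : ∀ a, ∃ b, x b = (x a)ᵀ ∧ y b = (y a)ᵀ)
    (hpt : pᵀ = p) (hqt : qᵀ = q) (hpp : p * p = p) (hqq : q * q = q)
    (hxp : ∀ a, x a * p = p * x a) (hyq : ∀ a, y a * q = q * y a)
    (htr : ∀ l : List ι, ((l.map x).prod * p).trace = ((l.map y).prod * q).trace)
    (hp0 : p ≠ 0) :
    ∃ T : Matrix (Fin n) (Fin n) ℝ, T ≠ 0 ∧ T * p = T ∧ q * T = T ∧ ∀ a, T * x a = y a * T := by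
  classical
  set C := pairAlg x y p q with hC
  have hgen : ∀ l : List ι, ((l.map x).prod * p, (l.map y).prod * q) ∈ C :=
    fun l => Submodule.subset_span ⟨l, rfl⟩
  have c1 : ∀ c ∈ C, c.1.trace = c.2.trace := by
    intro c hc
    refine Submodule.span_induction ?_ ?_ ?_ ?_ hc
    · rintro _ ⟨l, rfl⟩; exact htr l
    · simp
    · intro a b _ _ ha hb; simp [ha, hb]
    · intro r a _ ha; simp [ha]
  have c2 : ∀ c ∈ C, ∀ c' ∈ C, c * c' ∈ C := by
    intro c hc c' hc'
    have h : c * c' ∈ C * C := Submodule.mul_mem_mul hc hc'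
    rw [hC, pairAlg, Submodule.span_mul_span] at h
    refine Submodule.span_mono ?_ h
    rintro _ ⟨_, ⟨l, rfl⟩, _, ⟨l', rfl⟩, rfl⟩
    refine ⟨l ++ l', ?_⟩
    have e1 : (l.map x).prod * p * ((l'.map x).prod * p) = (l.map x).prod * (l'.map x).prod * p := by
      rw [mul_assoc, ← mul_assoc p, ← word_commute hxp, mul_assoc _ p p, hpp, mul_assoc]
    have e2 : (l.map y).prod * q * ((l'.map y).prod * q) = (l.map y).prod * (l'.map y).prod * q := by
      rw [mul_assoc, ← mul_assoc q, ← word_commute hyq, mul_assoc _ q q, hqq, mul_assoc]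
    simp [e1, e2]
  have c3 : ∀ c ∈ C, (c.1ᵀ, c.2ᵀ) ∈ C := by
    intro c hc
    refine Submodule.span_induction ?_ ?_ ?_ ?_ hc
    · rintro _ ⟨l, rfl⟩
      obtain ⟨l', h1, h2⟩ := word_transpose x y hs l
      have := hgen l'
      rw [word_commute hxp, word_commute hyq, h1, h2] at this
      simpa [transpose_mul, hpt, hqt] using this
    · simp only [Prod.fst_zero, Prod.snd_zero, transpose_zero, mul_zero]; exact C.zero_mem
    · intro a b _ _ ha hb; simpa using C.add_mem ha hb
    · intro r a _ ha; simpa using C.smul_mem r ha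
  have c4 : ∀ a, ∀ c ∈ C, (x a * c.1, y a * c.2) ∈ C := by
    intro a c hc
    refine Submodule.span_induction ?_ ?_ ?_ ?_ hc
    · rintro _ ⟨l, rfl⟩
      simpa [mul_assoc] using hgen (a :: l)
    · simp only [Prod.fst_zero, Prod.snd_zero, transpose_zero, mul_zero]; exact C.zero_mem
    · intro a b _ _ ha hb; simpa [mul_add] using C.add_mem ha hb
    · intro r a _ ha; simpa using C.smul_mem r ha
  have c5 : ∀ c ∈ C, p * c.1 = c.1 ∧ q * c.2 = c.2 := by
    intro c hc
    refine Submodule.span_induction ?_ ?_ ?_ ?_ hc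
    · rintro _ ⟨l, rfl⟩
      refine ⟨?_, ?_⟩
      · simp only [word_commute hxp]; rw [← mul_assoc, hpp]
      · simp only [word_commute hyq]; rw [← mul_assoc, hqq]
    · simp
    · intro a b _ _ ha hb; simp [mul_add, ha.1, ha.2, hb.1, hb.2]
    · intro r a _ ha; simp [ha.1, ha.2]
  have c6 : ∀ c ∈ C, c.1 = 0 → c.2 = 0 := by
    intro c hc h
    apply eq_zero_of_trace_sq
    have := c1 _ (c2 _ (c3 c hc) c hc)
    simp only [Prod.fst_mul, Prod.snd_mul] at this
    rw [← this, h]; simp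
  set A := C.map (LinearMap.fst ℝ _ _) with hA
  have hAm : ∀ c ∈ C, c.1 ∈ A := fun c hc => ⟨c, hc, rfl⟩
  have hdis : Disjoint A ((frob n).orthogonal A) := by
    rw [Submodule.disjoint_def]
    intro m h1 h2
    exact eq_zero_of_trace_sq (h2 m h1)
  have hcompl := (LinearMap.BilinForm.isCompl_orthogonal_iff_disjoint (frob_refl n)).2 hdis
  set L := C ⊔ ((frob n).orthogonal A).map (LinearMap.inl ℝ _ (Matrix (Fin n) (Fin n) ℝ)) with hL
  have hLm : ∀ t, t ∈ L ↔ ∃ c ∈ C, ∃ r ∈ (frob n).orthogonal A, t = (c.1 + r, c.2) := by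
    intro t
    rw [hL, Submodule.mem_sup]
    constructor
    · rintro ⟨c, hc, _, ⟨r, hr, rfl⟩, rfl⟩
      exact ⟨c, hc, r, hr, by ext <;> simp⟩
    · rintro ⟨c, hc, r, hr, rfl⟩
      exact ⟨c, hc, _, ⟨r, hr, rfl⟩, by ext <;> simp⟩
  have hinj : Function.Injective ((LinearMap.fst ℝ _ _).comp L.subtype) := by
    rw [← LinearMap.ker_eq_bot, eq_bot_iff]
    rintro ⟨t, ht⟩ h0
    obtain ⟨c, hc, r, hr, rfl⟩ := (hLm t).1 ht
    have h0' : c.1 + r = 0 := h0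
    have hr' : r = -c.1 := by rw [eq_neg_iff_add_eq_zero, add_comm]; exact h0'
    have hrA : r ∈ A := by rw [hr']; exact A.neg_mem (hAm c hc)
    have hr0 := (Submodule.disjoint_def.1 hdis) r hrA hr
    have hc0 : c.1 = 0 := by simpa [hr0] using h0'
    have := c6 c hc hc0
    rw [Submodule.mem_bot]
    ext <;> simp [hr0, hc0, this]
  have hsurj : Function.Surjective ((LinearMap.fst ℝ _ _).comp L.subtype) := by
    intro m
    have hm : m ∈ A ⊔ (frob n).orthogonal A := by
      rw [hcompl.sup_eq_top]; trivial
    obtain ⟨_, ⟨c, hc, rfl⟩, r, hr, rfl⟩ := Submodule.mem_sup.1 hm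
    exact ⟨⟨(c.1 + r, c.2), (hLm _).2 ⟨c, hc, r, hr, rfl⟩⟩, rfl⟩
  let E := LinearEquiv.ofBijective _ ⟨hinj, hsurj⟩
  let Ψ : Matrix (Fin n) (Fin n) ℝ →ₗ[ℝ] Matrix (Fin n) (Fin n) ℝ :=
    ((LinearMap.snd ℝ _ _).comp L.subtype).comp E.symm.toLinearMap
  have hΨL : ∀ t ∈ L, Ψ t.1 = t.2 := by
    intro t ht
    have : E.symm t.1 = ⟨t, ht⟩ := by
      rw [LinearEquiv.symm_apply_eq]; rfl
    change (E.symm t.1 : _).1.2 = t.2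
    rw [this]
  have hΨm : ∀ m, (m, Ψ m) ∈ L := by
    intro m
    obtain ⟨⟨t, ht⟩, h⟩ := hsurj m
    have h' : t.1 = m := h
    rw [← h', hΨL t ht]; exact ht
  have hlin : ∀ g h : Matrix (Fin n) (Fin n) ℝ, (∀ c ∈ C, (g * c.1, h * c.2) ∈ C) →
      (∀ c ∈ C, gᵀ * c.1 ∈ A) → ∀ m, Ψ (g * m) = h * Ψ m := by
    intro g h h1 h2 m
    obtain ⟨c, hc, r, hr, e⟩ := (hLm _).1 (hΨm m)
    obtain ⟨e1, e2⟩ := Prod.mk.inj e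
    rw [e2, e1]
    refine hΨL (g * (c.1 + r), h * c.2) ((hLm _).2 ⟨_, h1 c hc, g * r, ?_, ?_⟩)
    · rintro _ ⟨c', hc', rfl⟩
      have := hr _ (h2 c' hc')
      change frob n _ _ = 0 at this
      change frob n _ _ = 0
      rw [frob_apply] at this ⊢
      rw [transpose_mul, transpose_transpose, mul_assoc] at this
      exact this
    · simp [mul_add]
  have hΨx : ∀ a m, Ψ (x a * m) = y a * Ψ m := by
    intro a
    refine hlin _ _ (c4 a) ?_
    intro c hc
    obtain ⟨b, hb, _⟩ := hs a
    rw [← hb]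
    exact hAm _ (c4 b c hc)
  have hΨp : ∀ m, Ψ (p * m) = q * Ψ m := by
    refine hlin _ _ ?_ ?_
    · intro c hc
      rw [(c5 c hc).1, (c5 c hc).2]; exact hc
    · intro c hc
      rw [hpt, (c5 c hc).1]; exact hAm c hc
  have hqΨ : ∀ m, q * Ψ m = Ψ m := by
    intro m
    obtain ⟨c, hc, r, hr, e⟩ := (hLm _).1 (hΨm m)
    obtain ⟨e1, e2⟩ := Prod.mk.inj e
    rw [e2, (c5 c hc).2]
  have hΨpq : Ψ p = q := by
    refine hΨL (p, q) ((hLm _).2 ⟨(p, q), ?_, 0, Submodule.zero_mem _, by simp⟩)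
    simpa using hgen []
  let T : Fin n → Fin n → Matrix (Fin n) (Fin n) ℝ := fun k l =>
    Matrix.of fun i j => Ψ (Matrix.single j k 1) i l
  have hTg : ∀ g h : Matrix (Fin n) (Fin n) ℝ, (∀ m, Ψ (g * m) = h * Ψ m) →
      ∀ k l, T k l * g = h * T k l := by
    intro g h hgh k l
    ext i j
    have e : g * Matrix.single j k 1 = ∑ s, g s j • Matrix.single s k (1 : ℝ) := by
      ext i' j'
      simp [Matrix.mul_apply, Matrix.single_apply, Matrix.sum_apply, ite_and]
    have h1 := congrFun (congrFun (hgh (Matrix.single j k 1)) i) l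
    rw [e, map_sum] at h1
    simp only [map_smul, Matrix.sum_apply, Matrix.smul_apply, smul_eq_mul] at h1
    rw [Matrix.mul_apply] at h1
    rw [Matrix.mul_apply, Matrix.mul_apply]
    simp only [T, Matrix.of_apply]
    rw [← h1]
    exact Finset.sum_congr rfl fun s _ => mul_comm _ _
  have hTq : ∀ k l, q * T k l = T k l := by
    intro k l
    ext i j
    have h1 := congrFun (congrFun (hqΨ (Matrix.single j k 1)) i) l
    rw [Matrix.mul_apply] at h1 ⊢
    exact h1
  have hne : ∃ k l, T k l ≠ 0 := by
    by_contra! hcon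
    have hz : ∀ m, Ψ m = 0 := by
      intro m
      have e : m = ∑ j, ∑ k, m j k • Matrix.single j k (1 : ℝ) := by
        conv_lhs => rw [Matrix.matrix_eq_sum_single m]
        simp
      have hs0 : ∀ j k, Ψ (Matrix.single j k 1) = 0 := by
        intro j k
        ext i l
        exact congrFun (congrFun (hcon k l) i) j
      rw [e]
      simp only [map_sum, map_smul, hs0, smul_zero, Finset.sum_const_zero]
    have hq0 : q = 0 := by rw [← hΨpq, hz]
    apply hp0
    apply eq_zero_of_trace_sq
    have := htr []
    simp only [List.map_nil, List.prod_nil, one_mul, hq0, trace_zero] at this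
    rw [hpt, hpp, this]
  obtain ⟨k, l, hkl⟩ := hne
  refine ⟨T k l, hkl, ?_, hTq k l, fun a => hTg _ _ (hΨx a) k l⟩
  rw [hTg _ _ hΨp k l, hTq]

end inter

/-- A nonzero spectral projection of a nonzero symmetric matrix. -/
lemma exists_spectral_proj {n : ℕ} (H : Matrix (Fin n) (Fin n) ℝ) (hH : Hᵀ = H) (h0 : H ≠ 0) :
    ∃ (r : ℝ) (e : Matrix (Fin n) (Fin n) ℝ), r ≠ 0 ∧ e ≠ 0 ∧ eᵀ = e ∧ e * e = e ∧
      H * e = r • e ∧ ∀ M, M * H = H * M → M * e = e * M := by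
  classical
  have hA : H.IsHermitian := by
    unfold Matrix.IsHermitian
    rw [conjTranspose_eq_transpose_of_trivial, hH]
  set U : Matrix (Fin n) (Fin n) ℝ := hA.eigenvectorUnitary.1 with hU
  have hU1 : Uᵀ * U = 1 := by
    have := (Unitary.coe_star_mul_self hA.eigenvectorUnitary)
    rwa [star_eq_conjTranspose, conjTranspose_eq_transpose_of_trivial] at this
  have hU2 : U * Uᵀ = 1 := mul_eq_one_comm.1 hU1
  set D := hA.eigenvalues with hD
  have hsp : H = U * diagonal D * Uᵀ := by
    have h1 := hA.spectral_theorem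
    rw [Unitary.conjStarAlgAut_apply] at h1
    rw [star_eq_conjTranspose, conjTranspose_eq_transpose_of_trivial] at h1
    exact h1
  have hex : ∃ i, D i ≠ 0 := by
    by_contra! hcon
    apply h0
    have : D = 0 := funext hcon
    rw [hsp, this]; simp
  obtain ⟨i, hi⟩ := hex
  set χ : Fin n → ℝ := fun j => if D j = D i then 1 else 0 with hχ
  have hm : ∀ a b : Matrix (Fin n) (Fin n) ℝ, (U * a * Uᵀ) * (U * b * Uᵀ) = U * (a * b) * Uᵀ := by
    intro a b
    calc (U * a * Uᵀ) * (U * b * Uᵀ) = U * a * (Uᵀ * U) * b * Uᵀ := by simp only [mul_assoc]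
      _ = _ := by rw [hU1]; simp only [mul_assoc, one_mul]
  refine ⟨D i, U * diagonal χ * Uᵀ, hi, ?_, ?_, ?_, ?_, ?_⟩
  · intro hz
    have h1 : Uᵀ * (U * diagonal χ * Uᵀ) * U = diagonal χ := by
      calc Uᵀ * (U * diagonal χ * Uᵀ) * U = (Uᵀ * U) * diagonal χ * (Uᵀ * U) := by
            simp only [mul_assoc]
        _ = _ := by rw [hU1, one_mul, mul_one]
    rw [hz] at h1
    have := congrFun (congrFun h1 i) i
    simp [hχ] at this
  · simp [transpose_mul, mul_assoc]
  · rw [hm, diagonal_mul_diagonal]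
    congr 3
    ext j
    simp only [hχ]
    split_ifs <;> simp
  · conv_lhs => rw [hsp]
    rw [hm, diagonal_mul_diagonal, ← smul_mul_assoc, ← mul_smul_comm, ← diagonal_smul]
    congr 3
    ext j
    simp only [hχ, Pi.smul_apply, smul_eq_mul]
    split_ifs with h <;> simp [h]
  · intro M hM
    have hM' : M = U * (Uᵀ * M * U) * Uᵀ := by
      calc M = (U * Uᵀ) * M * (U * Uᵀ) := by rw [hU2, one_mul, mul_one]
        _ = _ := by simp only [mul_assoc]
    set N := Uᵀ * M * U with hN
    have hND : N * diagonal D = diagonal D * N := by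
      have h2 : Uᵀ * (M * H) * U = Uᵀ * (H * M) * U := by rw [hM]
      rw [hM', hsp, hm, hm] at h2
      have h3 : ∀ a, Uᵀ * (U * a * Uᵀ) * U = a := by
        intro a
        calc Uᵀ * (U * a * Uᵀ) * U = (Uᵀ * U) * a * (Uᵀ * U) := by simp only [mul_assoc]
          _ = _ := by rw [hU1, one_mul, mul_one]
      rwa [h3, h3] at h2
    rw [hM', hm, hm]
    congr 2
    ext a b
    have h4 := congrFun (congrFun hND a) b
    rw [mul_diagonal, diagonal_mul] at h4 ⊢
    by_cases hab : D a = D b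
    · simp only [hχ, hab]; ring
    · have : N a b = 0 := by
        have h5 : N a b * (D b - D a) = 0 := by linarith
        rcases mul_eq_zero.1 h5 with h6 | h6
        · exact h6
        · exact absurd (by linarith) hab
      simp [this]

end SpechtAux

namespace SpechtAux

lemma rank_sub_lt {n : ℕ} {p e : Matrix (Fin n) (Fin n) ℝ} (hpp : p * p = p) (hpe : p * e = e)
    (hep : e * p = e) (hee : e * e = e) (he : e ≠ 0) : (p - e).rank < p.rank := by
  unfold Matrix.rank
  apply Submodule.finrank_lt_finrank_of_lt
  refine lt_of_le_of_ne ?_ ?_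
  · rintro _ ⟨v, rfl⟩
    refine ⟨(p - e).mulVec v, ?_⟩
    rw [Matrix.mulVecLin_apply, Matrix.mulVecLin_apply, Matrix.mulVec_mulVec, mul_sub, hpp, hpe]
  · intro heq
    apply he
    apply Matrix.toLin'.injective
    ext1 i
    apply LinearMap.ext_ring
    have h1 : e.mulVec (Pi.single i 1) ∈ LinearMap.range p.mulVecLin :=
      ⟨e.mulVec (Pi.single i 1), by rw [Matrix.mulVecLin_apply, Matrix.mulVec_mulVec, hpe]⟩
    rw [← heq] at h1
    obtain ⟨u, hu⟩ := h1
    have h2 : e.mulVec ((p - e).mulVec u) = e.mulVec (e.mulVec (Pi.single i 1)) := by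
      rw [← hu]; rfl
    rw [Matrix.mulVec_mulVec, Matrix.mulVec_mulVec, mul_sub, hep, hee, sub_self,
      Matrix.zero_mulVec] at h2
    simpa using h2.symm

lemma exists_partial_isometry {ι : Type*} {n : ℕ} (x y : ι → Matrix (Fin n) (Fin n) ℝ)
    (hs : ∀ a, ∃ b, x b = (x a)ᵀ ∧ y b = (y a)ᵀ) (r : ℕ) :
    ∀ (p q : Matrix (Fin n) (Fin n) ℝ), p.rank ≤ r →
    pᵀ = p → qᵀ = q → p * p = p → q * q = q →
    (∀ a, x a * p = p * x a) → (∀ a, y a * q = q * y a) →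
    (∀ l : List ι, ((l.map x).prod * p).trace = ((l.map y).prod * q).trace) →
    ∃ U : Matrix (Fin n) (Fin n) ℝ, Uᵀ * U = p ∧ U * Uᵀ = q ∧ U * p = U ∧ q * U = U ∧
      ∀ a, U * x a = y a * U := by
  induction r with
  | zero =>
    intro p q hr hpt hqt hpp hqq hxp hyq htr
    have hp0 : p = 0 := by
      by_contra hne
      have := rank_sub_lt hpp hpp hpp hpp hne
      omega
    have hq0 : q = 0 := by
      apply eq_zero_of_trace_sq
      have := htr []
      simp only [List.map_nil, List.prod_nil, one_mul, hp0, trace_zero] at this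
      rw [hqt, hqq, this]
    exact ⟨0, by simp [hp0, hq0]⟩
  | succ r ih =>
    intro p q hr hpt hqt hpp hqq hxp hyq htr
    by_cases hp0 : p = 0
    · exact ih p q (by simp [hp0]) hpt hqt hpp hqq hxp hyq htr
    obtain ⟨T, hT0, hTp, hqT, hTx⟩ :=
      exists_intertwiner x y p q hs hpt hqt hpp hqq hxp hyq htr hp0
    have hTt : ∀ a, Tᵀ * y a = x a * Tᵀ := by
      intro a
      obtain ⟨b, hb1, hb2⟩ := hs a
      have := congrArg transpose (hTx b)
      rw [transpose_mul, transpose_mul, hb1, hb2, transpose_transpose, transpose_transpose] at this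
      exact this.symm
    have hpTt : p * Tᵀ = Tᵀ := by
      have := congrArg transpose hTp
      rwa [transpose_mul, hpt] at this
    have hH0 : Tᵀ * T ≠ 0 := fun h => hT0 (eq_zero_of_trace_sq (by rw [h]; simp))
    obtain ⟨c, e, hc, he, het, hee, hHe, hcomm⟩ :=
      exists_spectral_proj (Tᵀ * T) (by simp [transpose_mul]) hH0
    have hpe : p * e = e := by
      have h1 : p * (Tᵀ * T * e) = Tᵀ * T * e := by
        rw [← mul_assoc, ← mul_assoc, hpTt]
      rw [hHe, mul_smul_comm] at h1
      exact smul_right_injective _ hc h1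
    have hep : e * p = e := by
      have := congrArg transpose hpe
      rwa [transpose_mul, hpt, het] at this
    have hxe : ∀ a, x a * e = e * x a := by
      intro a
      apply hcomm
      rw [← mul_assoc, ← hTt, mul_assoc, ← hTx, mul_assoc]
    have hTeTe : (T * e)ᵀ * (T * e) = c • e := by
      rw [transpose_mul, het, mul_assoc, ← mul_assoc Tᵀ, hHe, mul_smul_comm, hee]
    have hcpos : 0 < c := by
      have h1 : 0 ≤ ((T * e)ᵀ * (T * e)).trace := by
        rw [trace]
        exact Finset.sum_nonneg fun i _ => by
          rw [diag_apply, mul_apply]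
          exact Finset.sum_nonneg fun j _ => mul_self_nonneg _
      have h2 : 0 ≤ (eᵀ * e).trace := by
        rw [trace]
        exact Finset.sum_nonneg fun i _ => by
          rw [diag_apply, mul_apply]
          exact Finset.sum_nonneg fun j _ => mul_self_nonneg _
      have h3 : (eᵀ * e).trace ≠ 0 := fun h => he (eq_zero_of_trace_sq h)
      rw [het, hee] at h2 h3
      rw [hTeTe, trace_smul, smul_eq_mul] at h1
      have h4 : 0 < e.trace := lt_of_le_of_ne h2 (Ne.symm h3)
      have h5 : 0 ≤ c := nonneg_of_mul_nonneg_left h1 h4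
      exact lt_of_le_of_ne h5 (Ne.symm hc)
    set s := (Real.sqrt c)⁻¹ with hs'
    have hss : s * s * c = 1 := by
      rw [hs', ← mul_inv, Real.mul_self_sqrt hcpos.le, inv_mul_cancel₀ hc]
    set V := s • (T * e) with hV
    have hVV : Vᵀ * V = e := by
      rw [hV, transpose_smul, smul_mul_assoc, mul_smul_comm, hTeTe, smul_smul, smul_smul,
        hss, one_smul]
    have hVe : V * e = V := by rw [hV, smul_mul_assoc, mul_assoc, hee]
    have hqV : q * V = V := by rw [hV, mul_smul_comm, ← mul_assoc, hqT]
    have hVx : ∀ a, V * x a = y a * V := by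
      intro a
      rw [hV, smul_mul_assoc, mul_smul_comm, mul_assoc, ← hxe, ← mul_assoc, hTx, mul_assoc]
    have hVt : ∀ a, Vᵀ * y a = x a * Vᵀ := by
      intro a
      obtain ⟨b, hb1, hb2⟩ := hs a
      have := congrArg transpose (hVx b)
      rw [transpose_mul, transpose_mul, hb1, hb2, transpose_transpose, transpose_transpose] at this
      exact this.symm
    have heVt : e * Vᵀ = Vᵀ := by
      have := congrArg transpose hVe
      rwa [transpose_mul, het] at this
    set f := V * Vᵀ with hf
    have hft : fᵀ = f := by simp [hf, transpose_mul]
    have hff : f * f = f := by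
      rw [hf, mul_assoc, ← mul_assoc Vᵀ, hVV, heVt]
    have hqf : q * f = f := by rw [hf, ← mul_assoc, hqV]
    have hfq : f * q = f := by
      have := congrArg transpose hqf
      rwa [transpose_mul, hft, hqt] at this
    have hfV : f * V = V := by rw [hf, mul_assoc, hVV, hVe]
    have hyf : ∀ a, y a * f = f * y a := by
      intro a
      rw [hf, ← mul_assoc, ← hVx, mul_assoc, ← hVt, mul_assoc]
    have hwV : ∀ l : List ι, V * (l.map x).prod = (l.map y).prod * V := by
      intro l
      induction l with
      | nil => simp
      | cons a l ihl =>
        rw [List.map_cons, List.prod_cons, List.map_cons, List.prod_cons, ← mul_assoc, hVx,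
          mul_assoc, ihl, mul_assoc]
    have htre : ∀ l : List ι, ((l.map x).prod * e).trace = ((l.map y).prod * f).trace := by
      intro l
      rw [hf, ← mul_assoc, ← hwV, trace_mul_comm _ Vᵀ, ← mul_assoc, hVV, trace_mul_comm]
    obtain ⟨U, hU1, hU2, hU3, hU4, hU5⟩ := ih (p - e) (q - f)
      (by have := rank_sub_lt hpp hpe hep hee he; omega)
      (by rw [transpose_sub, hpt, het]) (by rw [transpose_sub, hqt, hft])
      (by rw [sub_mul, mul_sub, mul_sub, hpp, hpe, hep, hee]; abel)
      (by rw [sub_mul, mul_sub, mul_sub, hqq, hqf, hfq, hff]; abel)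
      (fun a => by rw [mul_sub, sub_mul, hxp, hxe]) (fun a => by rw [mul_sub, sub_mul, hyq, hyf])
      (fun l => by rw [mul_sub, mul_sub, trace_sub, trace_sub, htr, htre])
    have hUp : U * p = U := by
      rw [← hU3, mul_assoc, sub_mul, hpp, hep]
    have hUe : U * e = 0 := by
      rw [← hU3, mul_assoc, sub_mul, hpe, hee, sub_self, mul_zero]
    have hqU : q * U = U := by
      rw [← hU4, ← mul_assoc, mul_sub, hqq, hqf]
    have hfU : f * U = 0 := by
      rw [← hU4, ← mul_assoc, mul_sub, hfq, hff, sub_self, zero_mul]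
    have hVtU : Vᵀ * U = 0 := by
      have h1 : Vᵀ * f = Vᵀ := by
        have := congrArg transpose hfV
        rwa [transpose_mul, hft] at this
      rw [← h1, mul_assoc, hfU, mul_zero]
    have hUtV : Uᵀ * V = 0 := by
      have := congrArg transpose hVtU
      rwa [transpose_mul, transpose_transpose, transpose_zero] at this
    have hUVt : U * Vᵀ = 0 := by
      rw [← heVt, ← mul_assoc, hUe, zero_mul]
    have hVUt : V * Uᵀ = 0 := by
      have := congrArg transpose hUVt
      rwa [transpose_mul, transpose_transpose, transpose_zero] at this
    have hVp : V * p = V := by rw [← hVe, mul_assoc, hep]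
    refine ⟨U + V, ?_, ?_, ?_, ?_, ?_⟩
    · rw [transpose_add, add_mul, mul_add, mul_add, hU1, hUtV, hVtU, hVV]; abel
    · rw [transpose_add, add_mul, mul_add, mul_add, hU2, hUVt, hVUt, ← hf]; abel
    · rw [add_mul, hUp, hVp]
    · rw [mul_add, hqU, hqV]
    · intro a
      rw [add_mul, mul_add, hU5, hVx]

lemma trace_nondeg {n : ℕ} (a : Matrix (Fin n) (Fin n) ℝ × Matrix (Fin n) (Fin n) ℝ)
    (h : ∀ b : Matrix (Fin n) (Fin n) ℝ × Matrix (Fin n) (Fin n) ℝ,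
      (a * b).1.trace - (a * b).2.trace = 0) : a = 0 := by
  have h1 := h (a.1ᵀ, 0)
  have h2 := h (0, a.2ᵀ)
  simp only [Prod.fst_mul, Prod.snd_mul, mul_zero, trace_zero, sub_zero, zero_sub,
    neg_eq_zero] at h1 h2
  rw [trace_mul_comm] at h1 h2
  exact Prod.ext (eq_zero_of_trace_sq h1) (eq_zero_of_trace_sq h2)

lemma prod_word {ι : Type*} {n : ℕ} (x y : ι → Matrix (Fin n) (Fin n) ℝ) (l : List ι) :
    (l.map fun a => (x a, y a)).prod = ((l.map x).prod, (l.map y).prod) := by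
  induction l with
  | nil => rfl
  | cons a l ih => simp [ih]

lemma long_words {ι : Type*} {n : ℕ} (hn : 0 < n) (x y : ι → Matrix (Fin n) (Fin n) ℝ)
    (h : ∀ l : List ι, l.length ≤ n ^ 2 → ((l.map x).prod).trace = ((l.map y).prod).trace)
    (l : List ι) : ((l.map x).prod).trace = ((l.map y).prod).trace := by
  haveI : Nonempty (Fin n) := ⟨⟨0, hn⟩⟩
  let τ : (Matrix (Fin n) (Fin n) ℝ × Matrix (Fin n) (Fin n) ℝ) →ₗ[ℝ] ℝ :=
    (traceLinearMap (Fin n) ℝ ℝ).comp (LinearMap.fst ℝ _ _)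
      - (traceLinearMap (Fin n) ℝ ℝ).comp (LinearMap.snd ℝ _ _)
  have hτ : ∀ a, τ a = a.1.trace - a.2.trace := fun a => rfl
  have key := trace_words (fun a => (x a, y a)) τ
    (fun a ha => trace_nondeg a fun b => ha b) (n ^ 2) (2 * n)
    (by simp [Module.finrank_prod, Module.finrank_matrix]; nlinarith) (by omega)
    (by
      have : (0 : ℤ) ≤ ((n : ℤ) - 2) ^ 2 := sq_nonneg _
      zify; nlinarith)
    (fun a => ⟨(x a).charpoly * (y a).charpoly,
      (charpoly_monic _).mul (charpoly_monic _), by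
        rw [(charpoly_monic _).natDegree_mul (charpoly_monic _)]
        simp; omega, by
        have h1 := Polynomial.aeval_algHom_apply (AlgHom.fst ℝ (Matrix (Fin n) (Fin n) ℝ)
          (Matrix (Fin n) (Fin n) ℝ)) (x a, y a) ((x a).charpoly * (y a).charpoly)
        have h2 := Polynomial.aeval_algHom_apply (AlgHom.snd ℝ (Matrix (Fin n) (Fin n) ℝ)
          (Matrix (Fin n) (Fin n) ℝ)) (x a, y a) ((x a).charpoly * (y a).charpoly)
        simp only [AlgHom.fst_apply, AlgHom.snd_apply, map_mul, aeval_self_charpoly, zero_mul,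
          mul_zero] at h1 h2
        rw [map_mul]
        exact Prod.ext h1.symm h2.symm⟩)
    (fun l hl => by rw [hτ, prod_word, h l hl, sub_self]) l
  rw [hτ, prod_word] at key
  exact sub_eq_zero.1 key

end SpechtAux

/-- Specht's theorem over `ℝ`: tuples `X, Y` of real `n×n` matrices are
simultaneously orthogonally similar iff all trace identities in words in the
matrices and their transposes hold, iff the trace identities for words of
length at most `n²` hold. -/
theorem specht_real (n d : ℕ) (hn : 0 < n) (hd : 0 < d)
    (X Y : Fin d → Matrix (Fin n) (Fin n) ℝ) :
    List.TFAE [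
      (∃ O : Matrix (Fin n) (Fin n) ℝ, O * Oᵀ = 1 ∧ ∀ i, O * X i * Oᵀ = Y i),
      (∀ w : FreeMonoid (Fin d ⊕ Fin d),
        Matrix.trace (FreeMonoid.lift (Sum.elim X (fun i => (X i)ᵀ)) w) =
        Matrix.trace (FreeMonoid.lift (Sum.elim Y (fun i => (Y i)ᵀ)) w)),
      (∀ w : FreeMonoid (Fin d ⊕ Fin d), w.length ≤ n ^ 2 →
        Matrix.trace (FreeMonoid.lift (Sum.elim X (fun i => (X i)ᵀ)) w) =
        Matrix.trace (FreeMonoid.lift (Sum.elim Y (fun i => (Y i)ᵀ)) w))] := by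
  tfae_have 1 → 2 := by
    rintro ⟨O, hO, h⟩ w
    have hO' : Oᵀ * O = 1 := mul_eq_one_comm.1 hO
    have hl : ∀ a, O * Sum.elim X (fun i => (X i)ᵀ) a * Oᵀ = Sum.elim Y (fun i => (Y i)ᵀ) a := by
      rintro (i | i)
      · exact h i
      · simp only [Sum.elim_inr]
        rw [← h i]
        simp [transpose_mul, mul_assoc]
    have hw : ∀ l : List (Fin d ⊕ Fin d),
        O * (l.map (Sum.elim X (fun i => (X i)ᵀ))).prod * Oᵀ
          = (l.map (Sum.elim Y (fun i => (Y i)ᵀ))).prod := by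
      intro l
      induction l with
      | nil => simp [hO]
      | cons a l ih =>
        rw [List.map_cons, List.prod_cons, List.map_cons, List.prod_cons, ← ih, ← hl]
        calc O * (Sum.elim X (fun i => (X i)ᵀ) a
              * (l.map (Sum.elim X (fun i => (X i)ᵀ))).prod) * Oᵀ
            = O * Sum.elim X (fun i => (X i)ᵀ) a * 1
              * (l.map (Sum.elim X (fun i => (X i)ᵀ))).prod * Oᵀ := by
                rw [mul_one]; simp only [mul_assoc]
          _ = _ := by rw [← hO']; simp only [mul_assoc]
    rw [FreeMonoid.lift_apply, FreeMonoid.lift_apply, ← hw, trace_mul_comm, ← mul_assoc, hO',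
      one_mul]
  tfae_have 2 → 3 := fun h w _ => h w
  tfae_have 3 → 1 := by
    intro h
    have hall := SpechtAux.long_words hn (Sum.elim X (fun i => (X i)ᵀ))
      (Sum.elim Y (fun i => (Y i)ᵀ)) (fun l hl => by
        have := h (FreeMonoid.ofList l) hl
        rwa [FreeMonoid.lift_apply, FreeMonoid.lift_apply] at this)
    obtain ⟨U, hU1, hU2, -, -, hU5⟩ := SpechtAux.exists_partial_isometry
      (Sum.elim X (fun i => (X i)ᵀ)) (Sum.elim Y (fun i => (Y i)ᵀ))
      (by
        rintro (i | i)
        · exact ⟨Sum.inr i, rfl, rfl⟩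
        · exact ⟨Sum.inl i, by simp, by simp⟩)
      _ 1 1 le_rfl (by simp) (by simp) (by simp) (by simp) (by simp) (by simp)
      (fun l => by rw [mul_one, mul_one]; exact hall l)
    refine ⟨U, hU2, fun i => ?_⟩
    have := hU5 (Sum.inl i)
    simp only [Sum.elim_inl] at this
    rw [this, mul_assoc, hU2, mul_one]
  tfae_finish
end

section
/- Let n, d ≥ 1 and let X₁, …, X_d, Y₁, …, Y_d ∈ M_n(ℂ). The following are equivalent: (1) there exists a unitary matrix O ∈ M_n(ℂ) (i.e. O·O* = I_n, where O* is the conjugate transpose) such that O·X_i·O* = Y_i for all i; (2) for every word w in the 2d letters x₁,…,x_d,x₁*,…,x_d*, tr(w(X₁,…,X_d,X₁*,…,X_d*)) = tr(w(Y₁,…,Y_d,Y₁*,…,Y_d*)); (3) the same trace equality holds for all such words of length at most n². -/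
open Matrix
namespace SpechtAux

/-- permutations supported in `S` -/
def G {α : Type*} [Fintype α] [DecidableEq α] (S : Finset α) : Finset (Equiv.Perm α) :=
  Finset.univ.filter (fun g => ∀ x, x ∉ S → g x = x)

section comb
variable {α : Type*} [Fintype α] [DecidableEq α]

lemma mem_G {S : Finset α} {g : Equiv.Perm α} : g ∈ G S ↔ ∀ x, x ∉ S → g x = x := by
  simp [G]

lemma G_mono {S T : Finset α} (h : S ⊆ T) : G S ⊆ G T := fun g hg =>
  mem_G.2 fun x hx => mem_G.1 hg x (fun h' => hx (h h'))

lemma one_mem_G (S : Finset α) : (1 : Equiv.Perm α) ∈ G S := mem_G.2 fun _ _ => rfl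

lemma mul_mem_G {S : Finset α} {g h : Equiv.Perm α} (hg : g ∈ G S) (hh : h ∈ G S) :
    g * h ∈ G S := mem_G.2 fun x hx => by
  rw [Equiv.Perm.mul_apply, mem_G.1 hh x hx, mem_G.1 hg x hx]

lemma swap_mem_G {S : Finset α} {x y : α} (hx : x ∈ S) (hy : y ∈ S) :
    Equiv.swap x y ∈ G S := mem_G.2 fun z hz => by
  apply Equiv.swap_apply_of_ne_of_ne <;> rintro rfl <;> contradiction

lemma sum_G_insert {M : Type*} [AddCommMonoid M] {B : Finset α} {x : α} (hx : x ∉ B)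
    (F : Equiv.Perm α → M) :
    ∑ g ∈ G (insert x B), F g = ∑ b ∈ insert x B, ∑ h ∈ G B, F (Equiv.swap x b * h) := by
  rw [← Finset.sum_product']
  symm
  refine Finset.sum_bij' (fun p _ => Equiv.swap x p.1 * p.2)
    (fun g _ => (g x, Equiv.swap x (g x) * g)) ?_ ?_ ?_ ?_ ?_
  · rintro ⟨b, h⟩ hp
    rw [Finset.mem_product] at hp
    exact mul_mem_G (swap_mem_G (Finset.mem_insert_self _ _) hp.1)
      (G_mono (Finset.subset_insert _ _) hp.2)
  · intro g hg
    rw [Finset.mem_product]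
    have hgx : g x ∈ insert x B := by
      by_contra h
      have := mem_G.1 hg _ h
      have := g.injective this
      exact h (by rw [this]; exact Finset.mem_insert_self _ _)
    refine ⟨hgx, mem_G.2 fun y hy => ?_⟩
    by_cases hyx : y = x
    · subst hyx; simp
    · have := mul_mem_G (swap_mem_G (Finset.mem_insert_self x B) hgx) hg
      exact mem_G.1 this y (by simp [hyx, hy])
  · rintro ⟨b, h⟩ hp
    rw [Finset.mem_product] at hp
    have := mem_G.1 hp.2 x hx
    simp [this]
  · intro g hg
    simp
  · intros; rfl

lemma swap_mul_comm_of {B : Finset α} {U : Finset α} (hd : Disjoint B U) {g h : Equiv.Perm α}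
    (hg : g ∈ G B) (hh : h ∈ G U) : g * h = h * g := by
  apply Equiv.Perm.Disjoint.commute
  intro x
  by_cases hx : x ∈ B
  · right; exact mem_G.1 hh x (Finset.disjoint_left.1 hd hx)
  · left; exact mem_G.1 hg x hx

variable {V : Type*} [AddCommGroup V] [Module ℂ V]

lemma G_card_pos (S : Finset α) : ((G S).card : ℂ) ≠ 0 := by
  have : 0 < (G S).card := Finset.card_pos.2 ⟨1, one_mem_G S⟩
  exact_mod_cast this.ne'

theorem comb_main (ρ : Equiv.Perm α →* Module.End ℂ V) (p : ℕ) :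
    ∀ (q : ℕ) (U : Finset α) (W : Submodule ℂ V),
      (∀ g ∈ G U, ∀ v ∈ W, ρ g v ∈ W) →
      (∀ S ⊆ U, S.card = p + 1 → ∀ v ∈ W, ∑ g ∈ G S, ρ g v = 0) →
      (∀ S ⊆ U, S.card = q + 1 → ∀ v ∈ W,
        ∑ g ∈ G S, ((Equiv.Perm.sign g : ℤ) : ℂ) • ρ g v = 0) →
      p * q < U.card → W = ⊥ := by
  intro q
  induction q with
  | zero =>
    intro U W _ _ ha hU
    obtain ⟨S, hSU, hS⟩ := Finset.exists_subset_card_eq (show 1 ≤ U.card by omega)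
    rw [eq_bot_iff]
    intro v hv
    have h := ha S hSU (by simpa using hS) v hv
    obtain ⟨x, rfl⟩ := Finset.card_eq_one.1 hS
    have : G ({x} : Finset α) = {1} := by
      ext g
      rw [mem_G, Finset.mem_singleton]
      constructor
      · intro h
        ext y
        by_cases hy : y = x
        · subst hy
          by_contra hne
          have h2 := h (g y) (by simpa using hne)
          exact hne (by simpa using h2)
        · exact h y (by simpa using hy)
      · rintro rfl; simp
    rw [this] at h
    simpa using h
  | succ q ih =>
    intro U W hstab hs ha hU
    by_contra hW
    obtain ⟨v₀, hv₀, hv₀ne⟩ := Submodule.exists_mem_ne_zero_of_ne_bot hW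
    -- the maximal B
    let good : Finset (Finset α) := by
      classical
      exact U.powerset.filter (fun B => ∃ v ∈ W, v ≠ 0 ∧ ∀ g ∈ G B, ρ g v = v)
    have hgood : ∀ B, B ∈ good ↔ B ⊆ U ∧ ∃ v ∈ W, v ≠ 0 ∧ ∀ g ∈ G B, ρ g v = v := by
      intro B; simp [good]
    have hne : good.Nonempty := by
      refine ⟨∅, (hgood _).2 ⟨by simp, v₀, hv₀, hv₀ne, ?_⟩⟩
      intro g hg
      have : g = 1 := by ext y; exact mem_G.1 hg y (by simp)
      simp [this]
    obtain ⟨B, hB, hmax⟩ := Finset.exists_max_image good Finset.card hne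
    obtain ⟨hBU, v, hv, hvne, hvfix⟩ := (hgood B).1 hB
    have hBp : B.card ≤ p := by
      by_contra hlt
      obtain ⟨S, hSB, hS⟩ := Finset.exists_subset_card_eq (show p + 1 ≤ B.card by omega)
      have h := hs S (hSB.trans hBU) hS v hv
      rw [Finset.sum_congr rfl (fun g hg => hvfix g (G_mono hSB hg)), Finset.sum_const,
        ← Nat.cast_smul_eq_nsmul ℂ] at h
      rcases smul_eq_zero.1 h with h | h
      · exact G_card_pos S h
      · exact hvne h
    let W' : Submodule ℂ V :=
      { carrier := {v | v ∈ W ∧ ∀ g ∈ G B, ρ g v = v}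
        add_mem' := by
          rintro a b ⟨ha, ha'⟩ ⟨hb, hb'⟩
          exact ⟨W.add_mem ha hb, fun g hg => by rw [map_add, ha' g hg, hb' g hg]⟩
        zero_mem' := ⟨W.zero_mem, fun g _ => map_zero _⟩
        smul_mem' := by
          rintro c a ⟨ha, ha'⟩
          exact ⟨W.smul_mem c ha, fun g hg => by rw [map_smul, ha' g hg]⟩ }
    have hW'W : W' ≤ W := fun v hv => hv.1
    have hdisj : Disjoint B (U \ B) := Finset.disjoint_sdiff
    have hstab' : ∀ g ∈ G (U \ B), ∀ v ∈ W', ρ g v ∈ W' := by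
      intro g hg v hv
      refine ⟨hstab g (G_mono Finset.sdiff_subset hg) v hv.1, fun h hh => ?_⟩
      rw [← Module.End.mul_apply, ← map_mul, swap_mul_comm_of hdisj hh hg, map_mul,
        Module.End.mul_apply, hv.2 h hh]
    have key : W' = ⊥ := by
      refine ih (U \ B) W' hstab' (fun S hS hc v hv =>
        hs S (hS.trans Finset.sdiff_subset) hc v hv.1) ?_ ?_
      · intro T hT hTc v hv
        have hTB : Disjoint B T := Finset.disjoint_of_subset_right hT hdisj
        have hTU : T ⊆ U := hT.trans Finset.sdiff_subset
        set w := ∑ g ∈ G T, ((Equiv.Perm.sign g : ℤ) : ℂ) • ρ g v with hw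
        have hwW' : w ∈ W' := Submodule.sum_mem _ fun g hg =>
          Submodule.smul_mem _ _ (hstab' g (G_mono hT hg) v hv)
        -- symmetric relation
        have h1 : ∀ x ∈ T, ∑ b ∈ B, ρ (Equiv.swap x b) w = - w := by
          intro x hx
          have hxB : x ∉ B := Finset.disjoint_right.1 hTB hx
          have hins : insert x B ⊆ U := Finset.insert_subset (hTU hx) hBU
          have hz : ∑ g ∈ G (insert x B), ρ g w = 0 := by
            by_contra hne0
            have hmem : insert x B ∈ good := by
              refine (hgood _).2 ⟨hins, _, ?_, hne0, ?_⟩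
              · exact Submodule.sum_mem _ fun g hg => hstab g (G_mono hins hg) w hwW'.1
              · intro g hg
                rw [map_sum]
                simp_rw [← Module.End.mul_apply, ← map_mul]
                refine Finset.sum_bij' (fun h _ => g * h) (fun h _ => g⁻¹ * h) ?_ ?_ ?_ ?_ ?_
                · intro h hh; exact mul_mem_G hg hh
                · intro h hh
                  refine mul_mem_G (mem_G.2 fun y hy => ?_) hh
                  rw [Equiv.Perm.inv_eq_iff_eq]; exact (mem_G.1 hg y hy).symm
                · intros; simp
                · intros; simp
                · intros; rfl
            have := hmax _ hmem
            rw [Finset.card_insert_of_notMem hxB] at this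
            omega
          rw [sum_G_insert hxB] at hz
          have : ∀ b ∈ insert x B, ∑ h ∈ G B, ρ (Equiv.swap x b * h) w
              = ((G B).card : ℂ) • ρ (Equiv.swap x b) w := by
            intro b _
            rw [Nat.cast_smul_eq_nsmul, ← Finset.sum_const]
            refine Finset.sum_congr rfl fun h hh => ?_
            rw [map_mul, Module.End.mul_apply, hwW'.2 h hh]
          rw [Finset.sum_congr rfl this, ← Finset.smul_sum] at hz
          have hz := (smul_eq_zero.1 hz).resolve_left (G_card_pos B)
          rw [Finset.sum_insert hxB] at hz
          simp only [Equiv.swap_self] at hz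
          have h1 : ρ (Equiv.refl α) w = w := by
            have := map_one ρ
            rw [show Equiv.refl α = (1 : Equiv.Perm α) from rfl, this]; rfl
          rw [h1] at hz
          exact eq_neg_of_add_eq_zero_right hz
        have h2 : ∀ b ∈ B, ∑ x ∈ T, ρ (Equiv.swap x b) w = w := by
          intro b hb
          have hbT : b ∉ T := Finset.disjoint_left.1 hTB hb
          have hz := ha (insert b T) (Finset.insert_subset (hBU hb) hTU)
            (by rw [Finset.card_insert_of_notMem hbT, hTc]) v hv.1
          rw [sum_G_insert hbT] at hz
          have : ∀ x ∈ insert b T, ∑ h ∈ G T,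
              ((Equiv.Perm.sign (Equiv.swap b x * h) : ℤ) : ℂ) • ρ (Equiv.swap b x * h) v
              = ((Equiv.Perm.sign (Equiv.swap b x) : ℤ) : ℂ) • ρ (Equiv.swap b x) w := by
            intro x _
            rw [hw, map_sum, Finset.smul_sum]
            refine Finset.sum_congr rfl fun h hh => ?_
            rw [map_mul, map_mul, Module.End.mul_apply, map_smul, smul_smul]
            push_cast
            rfl
          rw [Finset.sum_congr rfl this, Finset.sum_insert hbT] at hz
          have h1 : ρ (Equiv.refl α) w = w := by
            have := map_one ρ
            rw [show Equiv.refl α = (1 : Equiv.Perm α) from rfl, this]; rfl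
          have h3 : ∑ x ∈ T, ((Equiv.Perm.sign (Equiv.swap b x) : ℤ) : ℂ) • ρ (Equiv.swap b x) w
              = - ∑ x ∈ T, ρ (Equiv.swap x b) w := by
            rw [← Finset.sum_neg_distrib]
            refine Finset.sum_congr rfl fun x hx => ?_
            rw [Equiv.Perm.sign_swap (by rintro rfl; exact hbT hx), Equiv.swap_comm]
            simp
          rw [h3] at hz
          simp only [Equiv.swap_self, h1] at hz
          simp only [Equiv.Perm.sign_refl, Units.val_one, Int.cast_one, one_smul] at hz
          exact (add_neg_eq_zero.1 hz).symm
        have h3 : ∑ x ∈ T, ∑ b ∈ B, ρ (Equiv.swap x b) w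
            = ∑ b ∈ B, ∑ x ∈ T, ρ (Equiv.swap x b) w := Finset.sum_comm
        rw [Finset.sum_congr rfl h1, Finset.sum_congr rfl h2, Finset.sum_const,
          Finset.sum_const, smul_neg, eq_comm, ← add_eq_zero_iff_eq_neg, ← add_smul,
          ← Nat.cast_smul_eq_nsmul ℂ] at h3
        refine (smul_eq_zero.1 h3).resolve_left ?_
        rw [hTc]
        exact_mod_cast (by omega : B.card + (q + 1) ≠ 0)
      · rw [Finset.card_sdiff_of_subset hBU]
        rw [Nat.mul_succ] at hU
        have := Finset.card_le_card hBU
        omega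
    have : v ∈ W' := ⟨hv, hvfix⟩
    rw [key] at this
    exact hvne (by simpa using this)

end comb
section traces
variable {α β ι : Type*} [Fintype α] [DecidableEq α] [Fintype β] [DecidableEq β]
  [Fintype ι] [DecidableEq ι]

/-- the multilinear trace function attached to a permutation -/
noncomputable def T (A : α → Matrix ι ι ℂ) (σ : Equiv.Perm α) : ℂ :=
  ∑ i : α → ι, ∏ k, A k (i k) (i (σ k))

lemma T_conj (A : α → Matrix ι ι ℂ) (σ : Equiv.Perm α) (e : β ≃ α) (σ' : Equiv.Perm β)
    (h : ∀ b, e (σ' b) = σ (e b)) : T (fun b => A (e b)) σ' = T A σ := by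
  unfold T
  refine Fintype.sum_equiv (Equiv.arrowCongr e (Equiv.refl ι)) _ _ fun i => ?_
  refine Fintype.prod_equiv e _ _ fun b => ?_
  simp [Equiv.arrowCongr, ← h]

lemma T_class (A : α → Matrix ι ι ℂ) (π π' g : Equiv.Perm α) :
    T (fun b => A (π'⁻¹ b)) (π' * π * g) = T A (π * g * π') := by
  refine T_conj A _ π'⁻¹ _ fun b => ?_
  simp [Equiv.Perm.mul_apply]

lemma T_antisym' (A : α → Matrix ι ι ℂ) (S : Finset α) (hS : Fintype.card ι < S.card)
    (π : Equiv.Perm α) :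
    ∑ g ∈ G S, ((Equiv.Perm.sign g : ℤ) : ℂ) * T A (π * g) = 0 := by
  have hT : ∀ g : Equiv.Perm α, T A (π * g) =
      ∑ j : α → ι, ∏ k, A k (j (π⁻¹ k)) (j (g k)) := by
    intro g
    unfold T
    refine Fintype.sum_equiv (Equiv.arrowCongr π.symm (Equiv.refl ι)) _ _ fun i => ?_
    simp [Equiv.arrowCongr, Equiv.Perm.mul_apply]
  simp_rw [hT, Finset.mul_sum]
  rw [Finset.sum_comm]
  refine Finset.sum_eq_zero fun j _ => ?_
  obtain ⟨x, hx, y, hy, hxy, hj⟩ := Finset.exists_ne_map_eq_of_card_lt_of_maps_to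
    (s := S) (t := Finset.univ) (f := j) (by simpa using hS) (by intro a _; simp)
  have hθ : ∀ z, j (Equiv.swap x y z) = j z := by
    intro z
    rcases Equiv.swap_apply_eq_iff.1 (rfl : Equiv.swap x y z = _) with h
    by_cases h1 : z = x
    · subst h1; simp [hj]
    · by_cases h2 : z = y
      · subst h2; simp [hj]
      · rw [Equiv.swap_apply_of_ne_of_ne h1 h2]
  have hsw := swap_mem_G hx hy
  refine Finset.sum_involution (fun g _ => Equiv.swap x y * g) ?_ ?_ ?_ ?_
  · intro g hg
    rw [Equiv.Perm.sign_mul, Equiv.Perm.sign_swap hxy]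
    simp [Equiv.Perm.mul_apply, hθ]
  · intro g hg _ h
    have : Equiv.swap x y = 1 := by simpa using h
    exact hxy (Equiv.swap_eq_one_iff.1 this)
  · intro g hg; exact mul_mem_G hsw hg
  · intro g hg; simp [← mul_assoc]

lemma T_split (A : α → Matrix ι ι ℂ) (σ : Equiv.Perm α) (p : α → Prop) [DecidablePred p]
    (h : ∀ x, p (σ x) ↔ p x) :
    T A σ = T (fun k : {x // p x} => A k) (σ.subtypePerm h) *
      T (fun k : {x // ¬ p x} => A k) (σ.subtypePerm (fun x => not_congr (h x))) := by
  unfold T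
  rw [Finset.sum_mul_sum, ← Fintype.sum_prod_type']
  refine Fintype.sum_equiv (Equiv.piEquivPiSubtypeProd p (fun _ => ι)) _ _ fun i => ?_
  rw [← Fintype.prod_subtype_mul_prod_subtype p]
  simp [Equiv.piEquivPiSubtypeProd]

lemma path_prod (k : ℕ) : ∀ (A : Fin (k + 1) → Matrix ι ι ℂ) (a b : ι),
    (List.ofFn A).prod a b = ∑ i : Fin k → ι, ∏ j : Fin (k + 1),
      A j ((Fin.cons a i : Fin (k + 1) → ι) j) ((Fin.snoc i b : Fin (k + 1) → ι) j) := by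
  induction k with
  | zero => 
    intro A a b
    simp [Fin.snoc]
  | succ k ih =>
    intro A a b
    rw [List.ofFn_succ, List.prod_cons, Matrix.mul_apply]
    rw [← (Fin.consEquiv (fun _ : Fin (k + 1) => ι)).sum_comp, Fintype.sum_prod_type]
    refine Finset.sum_congr rfl fun c _ => ?_
    rw [ih, Finset.mul_sum]
    refine Finset.sum_congr rfl fun i _ => ?_
    rw [Fin.prod_univ_succ (n := k + 1)]
    simp only [Fin.consEquiv, Equiv.coe_fn_mk]
    rw [← Fin.cons_snoc_eq_snoc_cons]
    simp

lemma T_rotate (k : ℕ) (A : Fin (k + 1) → Matrix ι ι ℂ) :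
    T A (finRotate (k + 1)) = Matrix.trace (List.ofFn A).prod := by
  unfold T Matrix.trace
  rw [← (Fin.consEquiv (fun _ : Fin (k + 1) => ι)).sum_comp, Fintype.sum_prod_type]
  refine Finset.sum_congr rfl fun a _ => ?_
  rw [Matrix.diag_apply, path_prod]
  refine Finset.sum_congr rfl fun i _ => ?_
  rw [Fin.snoc_eq_cons_rotate]
  rfl

lemma cycle_equiv {k : ℕ} (hk : Fintype.card α = k + 1) (σ : Equiv.Perm α)
    (h : σ.IsCycleOn (Set.univ : Set α)) :
    ∃ e : Fin (k + 1) ≃ α, ∀ b, e (finRotate (k + 1) b) = σ (e b) := by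
  have : Nonempty α := Fintype.card_pos_iff.1 (by omega)
  obtain ⟨x⟩ := this
  have h' : σ.IsCycleOn ((Finset.univ : Finset α) : Set α) := by simpa using h
  let f : Fin (k + 1) → α := fun j => (σ ^ (j : ℕ)) x
  have hs : Function.Surjective f := by
    intro y
    obtain ⟨m, hm, hy⟩ := h'.exists_pow_eq (Finset.mem_univ x) (Finset.mem_univ y)
    exact ⟨⟨m, by simpa [hk] using hm⟩, hy⟩
  have hb : Function.Bijective f := by
    rw [Fintype.bijective_iff_surjective_and_card]
    exact ⟨hs, by simp [hk]⟩
  refine ⟨Equiv.ofBijective f hb, fun b => ?_⟩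
  simp only [Equiv.ofBijective_apply, f]
  rw [← Equiv.Perm.mul_apply, ← pow_succ']
  by_cases hb : b = Fin.last k
  · subst hb
    rw [finRotate_last]
    have := h'.pow_card_apply (Finset.mem_univ x)
    rw [Finset.card_univ, hk] at this
    simp [this]
  · rw [coe_finRotate_of_ne_last hb]

lemma exists_split (σ : Equiv.Perm α) (h : ¬ σ.IsCycleOn (Set.univ : Set α)) :
    ∃ p : α → Prop, (∀ x, p (σ x) ↔ p x) ∧ (∃ x, p x) ∧ ∃ x, ¬ p x := by
  have : ∃ x y, ¬ σ.SameCycle x y := by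
    by_contra hc
    push Not at hc
    exact h ⟨σ.bijective.bijOn_univ, fun x _ y _ => hc x y⟩
  obtain ⟨x, y, hxy⟩ := this
  exact ⟨fun z => σ.SameCycle x z, fun z => Equiv.Perm.sameCycle_apply_right, 
    ⟨x, Equiv.Perm.SameCycle.refl _ _⟩, ⟨y, hxy⟩⟩

end traces

section agree
variable {ι L : Type*} [Fintype ι] [DecidableEq ι]

lemma T_agree_of_lt (X Y : L → Matrix ι ι ℂ) (m : ℕ)
    (h : ∀ w : List L, w.length < m → trace (w.map X).prod = trace (w.map Y).prod) :
    ∀ (k : ℕ) (α : Type) [Fintype α] [DecidableEq α] (a : α → L) (σ : Equiv.Perm α),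
      Fintype.card α = k →
      (Fintype.card α < m ∨ ¬ σ.IsCycleOn (Set.univ : Set α)) → Fintype.card α ≤ m →
      T (fun x => X (a x)) σ = T (fun x => Y (a x)) σ := by
  intro k
  induction k using Nat.strong_induction_on with
  | _ k ih =>
    intro α _ _ a σ hk hor hle
    by_cases hc : σ.IsCycleOn (Set.univ : Set α)
    · have hlt : Fintype.card α < m := hor.resolve_right (not_not.2 hc)
      rcases k with _ | k
      · have := Fintype.card_eq_zero_iff.1 hk
        simp [T]
      · obtain ⟨e, he⟩ := cycle_equiv hk σ hc
        rw [← T_conj (fun x => X (a x)) σ e _ he, ← T_conj (fun x => Y (a x)) σ e _ he,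
          T_rotate, T_rotate]
        have := h (List.ofFn fun b => a (e b)) (by simp; omega)
        simpa [List.map_ofFn, Function.comp_def] using this
    · obtain ⟨p, hp, ⟨x, hx⟩, ⟨y, hy⟩⟩ := exists_split σ hc
      classical
      rw [T_split _ σ p hp, T_split _ σ p hp]
      have h1 : Fintype.card {x // p x} < Fintype.card α := Fintype.card_subtype_lt hy
      have h2 : Fintype.card {x // ¬ p x} < Fintype.card α :=
        Fintype.card_subtype_lt (x := x) (by simpa using hx)
      rw [ih _ (hk ▸ h1) {x // p x} (fun x => a x) _ rfl (Or.inl (by omega)) (by omega),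
        ih _ (hk ▸ h2) {x // ¬ p x} (fun x => a x) _ rfl (Or.inl (by omega)) (by omega)]

/-- right regular representation on functions -/
def reg (α : Type) : Equiv.Perm α →* Module.End ℂ (Equiv.Perm α → ℂ) where
  toFun g := 
    { toFun := fun f π => f (π * g)
      map_add' := fun _ _ => rfl
      map_smul' := fun _ _ => rfl }
  map_one' := by ext; simp
  map_mul' g h := by
    apply LinearMap.ext; intro f; funext π
    simp [mul_assoc]

lemma reg_apply (α : Type) (g π : Equiv.Perm α) (f : Equiv.Perm α → ℂ) :
    reg α g f π = f (π * g) := rfl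

lemma trace_step (X Y : L → Matrix ι ι ℂ) (m : ℕ) (hm : Fintype.card ι ^ 2 < m)
    (h : ∀ w : List L, w.length < m → trace (w.map X).prod = trace (w.map Y).prod)
    (w : List L) (hw : w.length = m) : trace (w.map X).prod = trace (w.map Y).prod := by
  obtain ⟨k, rfl⟩ : ∃ k, m = k + 1 := ⟨m - 1, by omega⟩
  obtain ⟨a, rfl⟩ : ∃ a : Fin (k + 1) → L, w = List.ofFn a := 
    ⟨fun i => w.get (i.cast hw.symm), by
      apply List.ext_getElem
      · simp [hw]
      · intro i h1 h2
        rw [List.getElem_ofFn]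
        rfl⟩
  let f : Equiv.Perm (Fin (k + 1)) → ℂ := fun σ => T (fun x => X (a x)) σ - T (fun x => Y (a x)) σ
  have hf0 : ∀ σ : Equiv.Perm (Fin (k + 1)), ¬ σ.IsCycleOn Set.univ → f σ = 0 := by
    intro σ hσ
    exact sub_eq_zero.2 (T_agree_of_lt X Y (k + 1) h _ _ a σ rfl (Or.inr hσ) (by simp))
  have hsgn : ∀ σ : Equiv.Perm (Fin (k + 1)), 
      ((Equiv.Perm.sign σ : ℤ) : ℂ) * f σ = (-1) ^ k * f σ := by
    intro σ
    by_cases hσ : σ.IsCycleOn Set.univ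
    · obtain ⟨e, he⟩ := cycle_equiv (k := k) (by simp) σ hσ
      have : Equiv.Perm.sign σ = (-1) ^ k := by
        have h2 := sign_finRotate (k + 1)
        have h3 : σ = e.permCongr (finRotate (k + 1)) := by
          refine Equiv.ext fun x => ?_
          rw [Equiv.permCongr_apply, he, Equiv.apply_symm_apply]
        rw [h3, Equiv.Perm.sign_permCongr, h2]; simp
      rw [this]; simp
    · simp [hf0 σ hσ]
  have hanti : ∀ S : Finset (Fin (k + 1)), S.card = Fintype.card ι + 1 → ∀ π π',
      ∑ g ∈ G S, ((Equiv.Perm.sign g : ℤ) : ℂ) * f (π * g * π') = 0 := by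
    intro S hS π π'
    have h1 : ∀ A : Fin (k + 1) → Matrix ι ι ℂ,
        ∑ g ∈ G S, ((Equiv.Perm.sign g : ℤ) : ℂ) * T A (π * g * π') = 0 := by
      intro A
      rw [← T_antisym' (fun b => A (π'⁻¹ b)) S (by omega) (π' * π)]
      exact Finset.sum_congr rfl fun g _ => by rw [T_class]
    simp only [f, mul_sub, Finset.sum_sub_distrib]
    rw [h1, h1, sub_zero]
  have hsym : ∀ S : Finset (Fin (k + 1)), S.card = Fintype.card ι + 1 → ∀ π π',
      ∑ g ∈ G S, f (π * g * π') = 0 := by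
    intro S hS π π'
    have h1 : ∀ g, f (π * g * π') = ((-1) ^ k * ((Equiv.Perm.sign π : ℤ) : ℂ) * 
        ((Equiv.Perm.sign π' : ℤ) : ℂ)) *
        (((Equiv.Perm.sign g : ℤ) : ℂ) * f (π * g * π')) := by
      intro g
      have h2 := hsgn (π * g * π')
      have h3 : ((-1 : ℂ) ^ k) * (-1) ^ k = 1 := by rw [← mul_pow]; simp
      calc f (π * g * π') = (-1) ^ k * ((-1) ^ k * f (π * g * π')) := by
            rw [← mul_assoc, h3, one_mul]
        _ = _ := by
          rw [← h2, Equiv.Perm.sign_mul, Equiv.Perm.sign_mul]; push_cast; ring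
    rw [Finset.sum_congr rfl (fun g _ => h1 g), ← Finset.mul_sum, hanti S hS, mul_zero]
  let W : Submodule ℂ (Equiv.Perm (Fin (k + 1)) → ℂ) :=
    { carrier := {f | (∀ S : Finset (Fin (k + 1)), S.card = Fintype.card ι + 1 → ∀ π π',
          ∑ g ∈ G S, ((Equiv.Perm.sign g : ℤ) : ℂ) * f (π * g * π') = 0) ∧
        (∀ S : Finset (Fin (k + 1)), S.card = Fintype.card ι + 1 → ∀ π π',
          ∑ g ∈ G S, f (π * g * π') = 0)}
      add_mem' := by
        rintro a b ⟨h1, h2⟩ ⟨h3, h4⟩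
        refine ⟨fun S hS π π' => ?_, fun S hS π π' => ?_⟩
        · simp [mul_add, Finset.sum_add_distrib, h1 S hS, h3 S hS]
        · simp [Finset.sum_add_distrib, h2 S hS, h4 S hS]
      zero_mem' := by constructor <;> simp
      smul_mem' := by
        rintro c a ⟨h1, h2⟩
        refine ⟨fun S hS π π' => ?_, fun S hS π π' => ?_⟩
        · have := h1 S hS π π'
          simp only [Pi.smul_apply, smul_eq_mul, mul_left_comm _ c]
          rw [← Finset.mul_sum, this, mul_zero]
        · simp [← Finset.mul_sum, h2 S hS] }
  have hW : W = ⊥ := by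
    refine comb_main (reg (Fin (k + 1))) (Fintype.card ι) (Fintype.card ι) Finset.univ W
      ?_ ?_ ?_ ?_
    · rintro g - v ⟨h1, h2⟩
      refine ⟨fun S hS π π' => ?_, fun S hS π π' => ?_⟩
      · simpa [reg_apply, mul_assoc] using h1 S hS π (π' * g)
      · simpa [reg_apply, mul_assoc] using h2 S hS π (π' * g)
    · rintro S - hS v ⟨h1, h2⟩
      funext π
      simpa [reg_apply] using h2 S hS π 1
    · rintro S - hS v ⟨h1, h2⟩
      funext π
      simpa [reg_apply] using h1 S hS π 1
    · simpa [sq] using hm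
  have hfW : f ∈ W := ⟨hanti, hsym⟩
  rw [hW, Submodule.mem_bot] at hfW
  have := congrFun hfW (finRotate (k + 1))
  simp only [f, T_rotate, Pi.zero_apply, sub_eq_zero] at this
  simpa [List.map_ofFn, Function.comp_def] using this

lemma trace_all (X Y : L → Matrix ι ι ℂ)
    (h : ∀ w : List L, w.length ≤ Fintype.card ι ^ 2 →
      trace (w.map X).prod = trace (w.map Y).prod) :
    ∀ (m : ℕ) (w : List L), w.length = m → trace (w.map X).prod = trace (w.map Y).prod := by
  intro m
  induction m using Nat.strong_induction_on with
  | _ m ih =>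
    intro w hw
    by_cases hm : Fintype.card ι ^ 2 < m
    · exact trace_step X Y m hm (fun w' hw' => ih _ hw' w' rfl) w hw
    · exact h w (by omega)

end agree

section spatial
variable {ι : Type*} [Fintype ι] [DecidableEq ι]

open ComplexOrder in
lemma tr0 {A : Matrix ι ι ℂ} (h : trace (Aᴴ * A) = 0) : A = 0 :=
  trace_conjTranspose_mul_self_eq_zero_iff.1 h

open ComplexOrder in
lemma spec_nonneg (R : Matrix ι ι ℂ) (t : ℝ) (ht : t ∈ spectrum ℝ (Rᴴ * R)) : 0 ≤ t := by
  have h := posSemidef_conjTranspose_mul_self R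
  rw [h.1.spectrum_real_eq_range_eigenvalues] at ht
  obtain ⟨i, rfl⟩ := ht
  exact h.eigenvalues_nonneg i

lemma exists_onb (N : Submodule ℂ (Matrix ι ι ℂ)) :
    ∃ (k : ℕ) (p : Fin k → Matrix ι ι ℂ), (∀ i, p i ∈ N) ∧
      ∀ a ∈ N, a = ∑ i, trace ((p i)ᴴ * a) • p i := by
  let L : Matrix ι ι ℂ ≃ₗ[ℂ] EuclideanSpace ℂ (ι × ι) :=
    (LinearEquiv.curry ℂ ℂ ι ι).symm.trans (WithLp.linearEquiv 2 ℂ (ι × ι → ℂ)).symm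
  have hL : ∀ a b : Matrix ι ι ℂ, inner ℂ (L a) (L b) = trace (aᴴ * b) := by
    intro a b
    simp only [EuclideanSpace.inner_eq_star_dotProduct, dotProduct, Fintype.sum_prod_type,
      trace, diag_apply, mul_apply, conjTranspose_apply]
    rw [Finset.sum_comm]
    refine Finset.sum_congr rfl fun x _ => Finset.sum_congr rfl fun y _ => ?_
    rw [mul_comm]
    rfl
  let N' := N.map L.toLinearMap
  let b := stdOrthonormalBasis ℂ N'
  have hmem : ∀ i, L.symm (b i : EuclideanSpace ℂ (ι × ι)) ∈ N := by
    intro i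
    obtain ⟨y, hy, hy'⟩ := (b i).2
    rw [← hy']; simpa using hy
  refine ⟨_, fun i => L.symm (b i : EuclideanSpace ℂ (ι × ι)), hmem, ?_⟩
  intro a ha
  have h := b.sum_repr' ⟨L a, a, ha, rfl⟩
  have h := congrArg (fun z : N' => L.symm (z : EuclideanSpace ℂ (ι × ι))) h
  simp only [LinearEquiv.symm_apply_apply] at h
  conv_lhs => rw [← h]
  rw [AddSubmonoidClass.coe_finsetSum, map_sum]
  refine Finset.sum_congr rfl fun i _ => ?_
  rw [← hL, LinearEquiv.apply_symm_apply, SetLike.val_smul, map_smul]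
  rfl

/-- the data of an involutive algebra of pairs -/
structure PairAlg (S : Submodule ℂ (Matrix ι ι ℂ × Matrix ι ι ℂ)) : Prop where
  one : (1, 1) ∈ S
  mul : ∀ a ∈ S, ∀ b ∈ S, (a.1 * b.1, a.2 * b.2) ∈ S
  star : ∀ a ∈ S, (a.1ᴴ, a.2ᴴ) ∈ S

lemma exists_intertwiner_s8 {S : Submodule ℂ (Matrix ι ι ℂ × Matrix ι ι ℂ)} (hS : PairAlg S)
    {P Q : Matrix ι ι ℂ} (hP : Pᴴ = P) (hPP : P * P = P) (hQ : Qᴴ = Q) (hQQ : Q * Q = Q)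
    (cP : ∀ a ∈ S, a.1 * P = P * a.1) (cQ : ∀ a ∈ S, a.2 * Q = Q * a.2)
    (htr : ∀ a ∈ S, trace (a.1 * P) = trace (a.2 * Q)) (hP0 : P ≠ 0) :
    ∃ R : Matrix ι ι ℂ, R ≠ 0 ∧ (∀ u ∈ S, u.2 * R = R * u.1) ∧ Q * R = R ∧ R * P = R := by
  let φ : (Matrix ι ι ℂ × Matrix ι ι ℂ) →ₗ[ℂ] Matrix ι ι ℂ :=
    (LinearMap.mulRight ℂ P).comp (LinearMap.fst ℂ _ _)
  obtain ⟨k, p, hpN, hp⟩ := exists_onb (S.map φ)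
  choose z hzS hz using fun i => (Submodule.mem_map.1 (hpN i))
  have hz : ∀ i, (z i).1 * P = p i := hz
  let q : Fin k → Matrix ι ι ℂ := fun i => (z i).2 * Q
  have key : ∀ a ∈ S, a.1 * P = 0 → a.2 * Q = 0 := by
    intro a ha h
    have h1 := htr _ (hS.mul _ (hS.star a ha) a ha)
    simp only [] at h1
    rw [mul_assoc, h, mul_zero, trace_zero] at h1
    apply tr0
    rw [conjTranspose_mul, hQ, trace_mul_comm, ← mul_assoc, mul_assoc a.2, hQQ, mul_assoc,
      trace_mul_comm, mul_assoc, trace_mul_comm, ← h1]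
  have exp2 : ∀ a ∈ S, a.2 * Q = ∑ i, trace ((p i)ᴴ * (a.1 * P)) • q i := by
    intro a ha
    have h1 := hp (a.1 * P) ⟨a, ha, rfl⟩
    have h2 : a - ∑ i, trace ((p i)ᴴ * (a.1 * P)) • z i ∈ S :=
      S.sub_mem ha (S.sum_mem fun i _ => S.smul_mem _ (hzS i))
    have h3 := key _ h2 ?_
    · simp only [Prod.snd_sub, Prod.snd_sum, Prod.smul_snd, sub_mul, Finset.sum_mul,
        smul_mul_assoc] at h3
      exact sub_eq_zero.1 h3
    · simp only [Prod.fst_sub, Prod.fst_sum, Prod.smul_fst, sub_mul, Finset.sum_mul,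
        smul_mul_assoc, hz]
      exact sub_eq_zero.2 h1
  let E : Matrix ι ι ℂ → Matrix ι ι ℂ := fun T => ∑ i, q i * T * (p i)ᴴ
  have hE : ∀ T, ∀ u ∈ S, u.2 * E T = E T * u.1 := by
    intro T u hu
    let c : Fin k → Fin k → ℂ := fun j i => trace ((p j)ᴴ * u.1 * p i)
    have h1 : ∀ i, u.2 * q i = ∑ j, c j i • q j := by
      intro i
      have := exp2 _ (hS.mul u hu (z i) (hzS i))
      simp only [mul_assoc, hz] at this
      simp only [q, c, mul_assoc]
      exact this
    have h2 : ∀ j, (p j)ᴴ * u.1 = ∑ i, c j i • (p i)ᴴ := by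
      intro j
      have h3 := hp (u.1ᴴ * p j) ⟨_, hS.mul _ (hS.star u hu) _ (hzS j), by
        simp [φ, mul_assoc, hz]⟩
      have h4 := congrArg conjTranspose h3
      rw [conjTranspose_mul, conjTranspose_conjTranspose, conjTranspose_sum] at h4
      rw [h4]
      refine Finset.sum_congr rfl fun i _ => ?_
      rw [conjTranspose_smul, ← trace_conjTranspose]
      simp [c, conjTranspose_mul, mul_assoc]
    simp only [E, Finset.mul_sum, Finset.sum_mul]
    have h5 : ∀ i, u.2 * (q i * T * (p i)ᴴ) = ∑ j, c j i • (q j * T * (p i)ᴴ) := by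
      intro i
      rw [← mul_assoc, ← mul_assoc, h1, Finset.sum_mul, Finset.sum_mul]
      simp
    have h6 : ∀ j, q j * T * (p j)ᴴ * u.1 = ∑ i, c j i • (q j * T * (p i)ᴴ) := by
      intro j
      rw [mul_assoc, h2, Finset.mul_sum]
      simp
    simp_rw [h5, h6]
    rw [Finset.sum_comm]
  have hEQ : ∀ T, Q * E T = E T := by
    intro T
    simp only [E, Finset.mul_sum]
    refine Finset.sum_congr rfl fun i _ => ?_
    rw [← mul_assoc, ← mul_assoc]
    simp only [q]
    rw [cQ _ (hzS i), ← mul_assoc, hQQ]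
  have hEP : ∀ T, E T * P = E T := by
    intro T
    simp only [E, Finset.sum_mul]
    refine Finset.sum_congr rfl fun i _ => ?_
    rw [mul_assoc]
    congr 1
    rw [← hz, conjTranspose_mul, hP, ← cP _ (hS.star _ (hzS i)), mul_assoc, hPP]
  by_contra hno
  push Not at hno
  have hE0 : ∀ T, E T = 0 := by
    intro T
    by_contra h
    exact hno (E T) h (hE T) (hEQ T) (hEP T)
  have hsum : ∑ i, trace (q i) * star (trace (p i)) = 0 := by
    have h1 : ∀ b c, ∑ i, q i b b * star (p i c c) = 0 := by
      intro b c
      have h2 := congrFun (congrFun (hE0 (single b c 1)) b) c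
      simp only [E, Matrix.sum_apply, Matrix.zero_apply] at h2
      rw [← h2]
      refine Finset.sum_congr rfl fun i _ => ?_
      simp [mul_apply, single_apply, Finset.sum_ite_eq, ite_and]
    have h3 : ∑ i, trace (q i) * star (trace (p i))
        = ∑ b, ∑ c, ∑ i, q i b b * star (p i c c) := by
      simp only [trace, diag_apply, star_sum, Finset.sum_mul_sum]
      rw [Finset.sum_comm]
      refine Finset.sum_congr rfl fun b _ => ?_
      rw [Finset.sum_comm]
    rw [h3]
    exact Finset.sum_eq_zero fun b _ => Finset.sum_eq_zero fun c _ => h1 b c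
  have hpt : ∀ i, trace (p i) = 0 := by
    have h1 : ∀ i, trace (q i) * star (trace (p i)) = ((Complex.normSq (trace (p i)) : ℝ) : ℂ) := by
      intro i
      have := htr _ (hzS i)
      rw [hz] at this
      rw [this, ← Complex.mul_conj]
      rfl
    simp_rw [h1] at hsum
    rw [← Complex.ofReal_sum, Complex.ofReal_eq_zero,
      Finset.sum_eq_zero_iff_of_nonneg (fun i _ => Complex.normSq_nonneg _)] at hsum
    intro i
    exact Complex.normSq_eq_zero.1 (hsum i (Finset.mem_univ i))
  have hPt : trace P = 0 := by
    have h1 := hp P ⟨(1, 1), hS.one, by simp [φ]⟩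
    rw [h1, trace_sum]
    simp [trace_smul, hpt]
  apply hP0
  apply tr0
  rw [hP, hPP, hPt]

lemma normalize (R : Matrix ι ι ℂ) :
    ∃ F : Matrix ι ι ℂ, (∀ a, Rᴴ * R * a = a * (Rᴴ * R) → F * a = a * F) ∧
      Fᴴ = F ∧ R * F * (Fᴴ * (Rᴴ * R) * F) = R * F ∧ (R * F = 0 → R = 0) := by
  let H := Rᴴ * R
  have hH : IsSelfAdjoint H := by
    simp [H, IsSelfAdjoint, star_eq_conjTranspose]
  have hfin : (spectrum ℝ H).Finite := Matrix.finite_real_spectrum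
  have hc : ∀ g : ℝ → ℝ, ContinuousOn g (spectrum ℝ H) := fun g => hfin.continuousOn g
  let f : ℝ → ℝ := fun t => (Real.sqrt t)⁻¹
  have hpos : ∀ t ∈ spectrum ℝ H, 0 ≤ t := fun t ht => spec_nonneg R t ht
  have hF : (cfc f H)ᴴ = cfc f H := by
    rw [← star_eq_conjTranspose]; exact (IsSelfAdjoint.cfc).star_eq
  have hid : cfc (fun t : ℝ => t) H = H := cfc_id' ℝ H
  have h0 : ∀ B, H * B = 0 → R * B = 0 := by
    intro B hB
    apply tr0
    rw [conjTranspose_mul, mul_assoc, ← mul_assoc Rᴴ, hB, mul_zero, trace_zero]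
  refine ⟨cfc f H, ?_, hF, ?_, ?_⟩
  · intro a ha
    exact Commute.cfc ha (by rw [hH.star_eq]; exact ha) f
  · rw [hF]
    have h1 : R * (cfc f H * (cfc f H * H * cfc f H) - cfc f H) = 0 := by
      apply h0
      have : H * (cfc f H * (cfc f H * H * cfc f H) - cfc f H)
          = cfc (fun t : ℝ => t * (f t * (f t * t * f t) - f t)) H := by
        rw [cfc_mul _ _ H (hc _) (hc _), cfc_sub _ _ H (hc _) (hc _),
          cfc_mul _ _ H (hc _) (hc _), cfc_mul _ _ H (hc _) (hc _), 
          cfc_mul _ _ H (hc _) (hc _), hid]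
      rw [this, cfc_congr (g := fun _ => (0 : ℝ)), cfc_const_zero]
      intro t ht
      have ht := hpos t ht
      simp only [f]
      by_cases h : t = 0
      · simp [h]
      · have h2 : Real.sqrt t ≠ 0 := by
          rw [Real.sqrt_ne_zero ht]; exact h
        have h3 : (Real.sqrt t)⁻¹ * t * (Real.sqrt t)⁻¹ = 1 := by
          nth_rewrite 2 [← Real.mul_self_sqrt ht]
          field_simp
        rw [h3]; ring
    rw [mul_sub, sub_eq_zero, ← mul_assoc] at h1
    exact h1
  · intro h
    have h1 : H * cfc f H * cfc (fun t : ℝ => Real.sqrt t) H = H := by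
      have : H * cfc f H * cfc (fun t : ℝ => Real.sqrt t) H
          = cfc (fun t : ℝ => t * f t * Real.sqrt t) H := by
        rw [cfc_mul _ _ H (hc _) (hc _), cfc_mul _ _ H (hc _) (hc _), hid]
      rw [this]
      conv_rhs => rw [← hid]
      refine cfc_congr fun t ht => ?_
      have ht := hpos t ht
      simp only [f]
      by_cases h : t = 0
      · simp [h]
      · have h2 : Real.sqrt t ≠ 0 := by
          rw [Real.sqrt_ne_zero ht]; exact h
        rw [mul_assoc, inv_mul_cancel₀ h2, mul_one]
    have h2 : H = 0 := by
      rw [← h1]; simp only [H]; rw [mul_assoc Rᴴ, h]; simp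
    exact tr0 (by rw [show Rᴴ * R = 0 from h2, trace_zero])

lemma spatial_main {S : Submodule ℂ (Matrix ι ι ℂ × Matrix ι ι ℂ)} (hS : PairAlg S)
    (htr : ∀ a ∈ S, trace a.1 = trace a.2) :
    ∃ U : Matrix ι ι ℂ, U * Uᴴ = 1 ∧ ∀ a ∈ S, a.2 * U = U * a.1 := by
  let C : Set (Matrix ι ι ℂ) := {U | (∀ u ∈ S, u.2 * U = U * u.1) ∧ U * Uᴴ * U = U}
  have hC : ((fun U : Matrix ι ι ℂ => LinearMap.ker U.mulVecLin) '' C).Nonempty :=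
    ⟨_, 0, ⟨by simp, by simp⟩, rfl⟩
  obtain ⟨_, ⟨U, ⟨hU, hUU⟩, rfl⟩, hmin⟩ :=
    (wellFounded_lt (α := Submodule ℂ (ι → ℂ))).has_min _ hC
  have hU' : ∀ u ∈ S, u.1 * Uᴴ = Uᴴ * u.2 := by
    intro u hu
    have := congrArg conjTranspose (hU _ (hS.star u hu))
    simpa using this.symm
  have hUU' : Uᴴ * U * Uᴴ = Uᴴ := by
    have := congrArg conjTranspose hUU
    simpa [mul_assoc] using this
  have hUP : U * (1 - Uᴴ * U) = 0 := by rw [mul_sub, ← mul_assoc, hUU, mul_one, sub_self]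
  have hPU : (1 - Uᴴ * U) * Uᴴ = 0 := by rw [sub_mul, hUU', one_mul, sub_self]
  have hUQ : Uᴴ * (1 - U * Uᴴ) = 0 := by rw [mul_sub, ← mul_assoc, hUU', mul_one, sub_self]
  by_cases hP0 : 1 - Uᴴ * U = 0
  · refine ⟨U, ?_, hU⟩
    rw [mul_eq_one_comm]
    exact (sub_eq_zero.1 hP0).symm
  exfalso
  obtain ⟨R, hR0, hR, hQR, hRP⟩ := exists_intertwiner_s8 hS (P := 1 - Uᴴ * U) (Q := 1 - U * Uᴴ)
    (by simp) (by rw [sub_mul, mul_assoc, hUP]; simp) (by simp)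
    (by rw [sub_mul, mul_assoc, hUQ]; simp)
    (fun a ha => by
      rw [mul_sub, sub_mul, ← mul_assoc, hU' a ha, mul_assoc, hU a ha, mul_assoc]; simp)
    (fun a ha => by
      rw [mul_sub, sub_mul, ← mul_assoc, hU a ha, mul_assoc, hU' a ha, mul_assoc]; simp)
    (fun a ha => by
      rw [mul_sub, mul_sub, trace_sub, trace_sub, mul_one, mul_one, htr a ha,
        ← mul_assoc, hU' a ha, mul_assoc, trace_mul_comm, mul_assoc]) hP0
  obtain ⟨F, hFc, hFs, hF, hF0⟩ := normalize R
  have hR' : ∀ u ∈ S, u.1 * Rᴴ = Rᴴ * u.2 := by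
    intro u hu
    have := congrArg conjTranspose (hR _ (hS.star u hu))
    simpa using this.symm
  have hPR : (1 - Uᴴ * U) * Rᴴ = Rᴴ := by
    have := congrArg conjTranspose hRP
    simpa using this
  have hFa : ∀ u ∈ S, F * u.1 = u.1 * F := fun u hu => hFc _ (by
    rw [mul_assoc, ← hR u hu, ← mul_assoc, ← hR' u hu, mul_assoc])
  have hFP : F * (1 - Uᴴ * U) = (1 - Uᴴ * U) * F := hFc _ (by
    rw [mul_assoc, hRP, ← mul_assoc, hPR])
  set V := R * F with hV
  have hVV : V * Vᴴ * V = V := by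
    have h0 : Vᴴ * V = Fᴴ * (Rᴴ * R) * F := by
      rw [hV, conjTranspose_mul]; simp only [mul_assoc]
    rw [mul_assoc, h0]
    exact hF
  have hVP : V * (1 - Uᴴ * U) = V := by rw [hV, mul_assoc, hFP, ← mul_assoc, hRP]
  have hQV : (1 - U * Uᴴ) * V = V := by rw [hV, ← mul_assoc, hQR]
  have h1 : Uᴴ * V = 0 := by rw [← hQV, ← mul_assoc, hUQ, zero_mul]
  have h2 : V * Uᴴ = 0 := by rw [← hVP, mul_assoc, hPU, mul_zero]
  have h3 : Vᴴ * U = 0 := by simpa using congrArg conjTranspose h1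
  have h4 : U * Vᴴ = 0 := by simpa using congrArg conjTranspose h2
  have hV0 : V ≠ 0 := fun h => hR0 (hF0 h)
  have hmem : U + V ∈ C := by
    refine ⟨fun u hu => ?_, ?_⟩
    · rw [mul_add, add_mul, hU u hu, hV, ← mul_assoc, hR u hu, mul_assoc, mul_assoc, hFa u hu]
    · have h5 : (U + V) * (U + V)ᴴ = U * Uᴴ + V * Vᴴ := by
        rw [conjTranspose_add, add_mul, mul_add, mul_add, h2, h4, add_zero, zero_add]
      rw [h5, add_mul, mul_add, mul_add, hUU, hVV, mul_assoc, mul_assoc, h1, h3]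
      simp
  refine hmin _ ⟨U + V, hmem, rfl⟩ (lt_of_le_of_ne ?_ ?_)
  · intro v hv
    simp only [LinearMap.mem_ker, mulVecLin_apply] at hv ⊢
    have h5 : U * Uᴴ * (U + V) = U := by
      rw [mul_add, hUU, mul_assoc, h1, mul_zero, add_zero]
    rw [← h5, ← mulVec_mulVec, hv, mulVec_zero]
  · intro heq
    apply hV0
    have h6 : V * Vᴴ = 0 := by
      refine Matrix.ext_of_mulVec_single fun i => ?_
      have h7 : Vᴴ *ᵥ Pi.single i 1 ∈ LinearMap.ker U.mulVecLin := by
        simp only [LinearMap.mem_ker, mulVecLin_apply, mulVec_mulVec, h4, zero_mulVec]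
      replace h7 := heq.symm.le h7
      simp only [LinearMap.mem_ker, mulVecLin_apply, mulVec_mulVec] at h7
      rw [add_mul, h4, zero_add] at h7
      rw [h7, zero_mulVec]
    rw [← hVV, h6, zero_mul]

lemma specht_core {L : Type*} (s : L → L) (X Y : L → Matrix ι ι ℂ)
    (hX : ∀ l, X (s l) = (X l)ᴴ) (hY : ∀ l, Y (s l) = (Y l)ᴴ)
    (h : ∀ w : List L, trace (w.map X).prod = trace (w.map Y).prod) :
    ∃ U : Matrix ι ι ℂ, U * Uᴴ = 1 ∧ ∀ l, Y l * U = U * X l := by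
  let ev : List L → Matrix ι ι ℂ × Matrix ι ι ℂ := fun w => ((w.map X).prod, (w.map Y).prod)
  let S := Submodule.span ℂ (Set.range ev)
  have hS : PairAlg S := by
    refine ⟨Submodule.subset_span ⟨[], by simp [ev]⟩, ?_, ?_⟩
    · intro a ha b hb
      have : a * b ∈ S * S := Submodule.mul_mem_mul ha hb
      rw [Submodule.span_mul_span] at this
      refine Submodule.span_mono ?_ this
      rintro _ ⟨_, ⟨w, rfl⟩, _, ⟨w', rfl⟩, rfl⟩
      exact ⟨w ++ w', by simp [ev]⟩
    · intro a ha
      induction ha using Submodule.span_induction with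
      | mem x hx =>
        obtain ⟨w, rfl⟩ := hx
        refine Submodule.subset_span ⟨(w.map s).reverse, ?_⟩
        simp only [ev, conjTranspose_list_prod, List.map_reverse, List.map_map]
        congr 3 <;> simp [Function.comp_def, hX, hY]
      | zero => simp only [Prod.fst_zero, Prod.snd_zero, conjTranspose_zero]; exact S.zero_mem
      | add x y _ _ hx hy => simpa using S.add_mem hx hy
      | smul c x _ hx => simpa using S.smul_mem (star c) hx
  obtain ⟨U, hU, hUS⟩ := spatial_main hS (by
    intro a ha
    induction ha using Submodule.span_induction with
    | mem x hx => obtain ⟨w, rfl⟩ := hx; exact h w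
    | zero => simp
    | add x y _ _ hx hy => simp [hx, hy]
    | smul c x _ hx => simp [hx])
  exact ⟨U, hU, fun l => hUS (X l, Y l) (Submodule.subset_span ⟨[l], by simp [ev]⟩)⟩
end spatial
end SpechtAux

/-- Specht's theorem over `ℂ`: tuples `X, Y` of complex `n×n` matrices are
simultaneously unitarily similar iff all trace identities in words in the
matrices and their conjugate transposes hold, iff the trace identities for
words of length at most `n²` hold. -/
theorem specht_complex (n d : ℕ) (hn : 0 < n) (hd : 0 < d)
    (X Y : Fin d → Matrix (Fin n) (Fin n) ℂ) :
    List.TFAE [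
      (∃ O : Matrix (Fin n) (Fin n) ℂ, O * Oᴴ = 1 ∧ ∀ i, O * X i * Oᴴ = Y i),
      (∀ w : FreeMonoid (Fin d ⊕ Fin d),
        Matrix.trace (FreeMonoid.lift (Sum.elim X (fun i => (X i)ᴴ)) w) =
        Matrix.trace (FreeMonoid.lift (Sum.elim Y (fun i => (Y i)ᴴ)) w)),
      (∀ w : FreeMonoid (Fin d ⊕ Fin d), w.length ≤ n ^ 2 →
        Matrix.trace (FreeMonoid.lift (Sum.elim X (fun i => (X i)ᴴ)) w) =
        Matrix.trace (FreeMonoid.lift (Sum.elim Y (fun i => (Y i)ᴴ)) w))] := by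
  have hl : ∀ (Z : Fin d → Matrix (Fin n) (Fin n) ℂ) (w : FreeMonoid (Fin d ⊕ Fin d)),
      FreeMonoid.lift (Sum.elim Z (fun i => (Z i)ᴴ)) w
        = ((FreeMonoid.toList w).map (Sum.elim Z (fun i => (Z i)ᴴ))).prod :=
    fun Z w => FreeMonoid.lift_apply _ _
  tfae_have 1 → 2 := by
    rintro ⟨O, hO, h⟩ w
    have hO' : Oᴴ * O = 1 := mul_eq_one_comm.1 hO
    have hw : ∀ w : List (Fin d ⊕ Fin d), (w.map (Sum.elim Y (fun i => (Y i)ᴴ))).prod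
        = O * (w.map (Sum.elim X (fun i => (X i)ᴴ))).prod * Oᴴ := by
      intro w
      induction w with
      | nil => simp [hO]
      | cons a w ih =>
        have ha : Sum.elim Y (fun i => (Y i)ᴴ) a
            = O * Sum.elim X (fun i => (X i)ᴴ) a * Oᴴ := by
          rcases a with i | i
          · simp [h]
          · simp [← h, mul_assoc]
        rw [List.map_cons, List.prod_cons, ih, ha, List.map_cons, List.prod_cons]
        simp only [mul_assoc]
        rw [← mul_assoc Oᴴ O, hO', one_mul]
    rw [hl, hl, hw, trace_mul_comm, ← mul_assoc, hO', one_mul]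
  tfae_have 2 → 3 := fun h w _ => h w
  tfae_have 3 → 1 := by
    intro h
    have h1 := SpechtAux.trace_all (Sum.elim X (fun i => (X i)ᴴ)) (Sum.elim Y (fun i => (Y i)ᴴ))
      (by
        intro w hw
        have := h (FreeMonoid.ofList w) (by
          rw [Fintype.card_fin] at hw; exact hw)
        rw [hl, hl] at this
        exact this)
    obtain ⟨U, hU, hUX⟩ := SpechtAux.specht_core (Sum.swap : Fin d ⊕ Fin d → Fin d ⊕ Fin d)
      (Sum.elim X (fun i => (X i)ᴴ)) (Sum.elim Y (fun i => (Y i)ᴴ))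
      (by rintro (i | i) <;> simp) (by rintro (i | i) <;> simp) (fun w => h1 _ w rfl)
    refine ⟨U, hU, fun i => ?_⟩
    have := hUX (Sum.inl i)
    simp only [Sum.elim_inl] at this
    rw [← this, mul_assoc, hU, mul_one]
  tfae_finish
end

section
/- Let F be a field, d, m ∈ ℕ, and let s₁,…,s_m and t be elements of the free group on d generators. Then the following are equivalent: (1) for every finite group G and every map g : Fin d → G, if the image of each s_j under the induced homomorphism FreeGroup (Fin d) → G equals 1 then the image of t equals 1; (2) for every map g from the d generators into the product group Π_{n ∈ ℕ} GL_n(F), if the image of each s_j under the induced homomorphism equals 1 then the image of t equals 1. (That is, the product Π_{n ∈ ℕ} GL_n(F) satisfies exactly the universal Horn sentences of group theory true in all finite groups.) -/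
open Matrix

theorem jacobson_int_aux : IsJacobsonRing ℤ := by
  rw [isJacobsonRing_iff_prime_eq]
  intro P hP
  by_cases h : P = ⊥
  · subst h
    refine le_antisymm ?_ Ideal.le_jacobson
    intro x hx
    have h1 := (Ideal.mem_jacobson_bot.mp hx) x
    rw [Int.isUnit_iff] at h1
    rw [Ideal.mem_bot]
    rcases h1 with h1 | h1 <;> nlinarith
  · have := hP.isMaximal h
    exact Ideal.jacobson_eq_self_of_isMaximal

theorem finite_field_aux (k : Type*) [Field k] [Algebra.FiniteType ℤ k] : Finite k := by
  have := jacobson_int_aux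
  have hf : Module.Finite ℤ k := finite_of_finite_type_of_isJacobsonRing ℤ k
  have hni : ¬ Function.Injective (algebraMap ℤ k) := by
    intro hi
    have : Algebra.IsIntegral ℤ k := Algebra.IsIntegral.of_finite ℤ k
    exact Int.not_isField (isField_of_isIntegral_of_isField hi (Field.toIsField k))
  rw [injective_iff_map_eq_zero] at hni
  push Not at hni
  obtain ⟨a, ha, ha0⟩ := hni
  apply Module.finite_of_fg_torsion k
  intro x
  refine ⟨⟨a, mem_nonZeroDivisors_of_ne_zero ha0⟩, ?_⟩
  change a • x = 0
  rw [Algebra.smul_def, ha, zero_mul]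

theorem exists_maximal_aux (A : Type*) [CommRing A] [IsDomain A] [Algebra.FiniteType ℤ A]
    (a : A) (ha : a ≠ 0) : ∃ P : Ideal A, P.IsMaximal ∧ Finite (A ⧸ P) ∧ a ∉ P := by
  have := jacobson_int_aux
  have hA : IsJacobsonRing A := isJacobsonRing_of_finiteType (A := ℤ)
  have hb : (⊥ : Ideal A).jacobson = ⊥ :=
    isJacobsonRing_iff_prime_eq.mp hA ⊥ Ideal.isPrime_bot
  have h1 : a ∉ (⊥ : Ideal A).jacobson := by rw [hb]; simpa using ha
  rw [Ideal.jacobson, Ideal.mem_sInf] at h1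
  push Not at h1
  obtain ⟨P, ⟨-, hP⟩, haP⟩ := h1
  refine ⟨P, hP, ?_, haP⟩
  let := Ideal.Quotient.field P
  have : Algebra.FiniteType ℤ (A ⧸ P) :=
    Algebra.FiniteType.of_surjective (Ideal.Quotient.mkₐ ℤ P) Ideal.Quotient.mk_surjective
  exact @finite_field_aux (A ⧸ P) _ this

theorem lift_comp_aux {α G H : Type*} [Group G] [Group H] (f : G →* H) (g : α → G)
    (w : FreeGroup α) : FreeGroup.lift (fun i => f (g i)) w = f (FreeGroup.lift g w) := by
  have : FreeGroup.lift (fun i => f (g i)) = f.comp (FreeGroup.lift g) := by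
    ext i; simp
  rw [this]; rfl

theorem exists_lift_aux {F : Type*} [Field F] (d n : ℕ) (g : Fin d → GL (Fin n) F) :
    ∃ A : Subalgebra ℤ F, Algebra.FiniteType ℤ A ∧ ∃ g' : Fin d → GL (Fin n) A,
      ∀ i, GeneralLinearGroup.map (n := Fin n) (A.val : A →+* F) (g' i) = g i := by
  let S : Set F := Set.range (fun p : Fin d × Fin n × Fin n => (g p.1).val p.2.1 p.2.2) ∪
    Set.range (fun p : Fin d × Fin n × Fin n => (g p.1)⁻¹.val p.2.1 p.2.2)
  have hS : S.Finite := (Set.finite_range _).union (Set.finite_range _)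
  have h1 : ∀ i a b, (g i).val a b ∈ Algebra.adjoin ℤ S := fun i a b =>
    Algebra.subset_adjoin (Or.inl ⟨(i, a, b), rfl⟩)
  have h2 : ∀ i a b, (g i)⁻¹.val a b ∈ Algebra.adjoin ℤ S := fun i a b =>
    Algebra.subset_adjoin (Or.inr ⟨(i, a, b), rfl⟩)
  have hinj : Function.Injective
      (RingHom.mapMatrix (m := Fin n) ((Algebra.adjoin ℤ S).val : Algebra.adjoin ℤ S →+* F)) :=
    Matrix.map_injective Subtype.val_injective
  let u : Fin d → Matrix (Fin n) (Fin n) (Algebra.adjoin ℤ S) :=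
    fun i => Matrix.of fun a b => ⟨(g i).val a b, h1 i a b⟩
  let v : Fin d → Matrix (Fin n) (Fin n) (Algebra.adjoin ℤ S) :=
    fun i => Matrix.of fun a b => ⟨(g i)⁻¹.val a b, h2 i a b⟩
  have hu : ∀ i, (RingHom.mapMatrix (m := Fin n)
      ((Algebra.adjoin ℤ S).val : Algebra.adjoin ℤ S →+* F)) (u i) = (g i).val := fun i => rfl
  have hv : ∀ i, (RingHom.mapMatrix (m := Fin n)
      ((Algebra.adjoin ℤ S).val : Algebra.adjoin ℤ S →+* F)) (v i) = (g i)⁻¹.val := fun i => rfl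
  refine ⟨Algebra.adjoin ℤ S, .adjoin_of_finite hS, fun i => ⟨u i, v i, ?_, ?_⟩, ?_⟩
  · apply hinj
    rw [map_mul, hu, hv, map_one, ← Units.val_mul, mul_inv_cancel, Units.val_one]
  · apply hinj
    rw [map_mul, hu, hv, map_one, ← Units.val_mul, inv_mul_cancel, Units.val_one]
  · intro i
    exact Units.ext (hu i)

theorem exists_embed_aux (F : Type*) [Field F] (G : Type) [Group G] [Finite G] :
    ∃ (n : ℕ) (f : G →* GL (Fin n) F), Function.Injective f := by
  classical
  let e := Finite.equivFin G
  let f1 : G →* Equiv.Perm (Fin (Nat.card G)) :=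
    (e.permCongrHom : Equiv.Perm G →* _).comp (MulAction.toPermHom G G)
  refine ⟨Nat.card G, ((Matrix.permMatrixHom (R := F)).comp f1).toHomUnits, ?_⟩
  intro x y hxy
  have h := congrArg Units.val hxy
  have h' : (f1 x)⁻¹.toPEquiv.toMatrix = ((f1 y)⁻¹.toPEquiv.toMatrix : Matrix _ _ F) := h
  have h2 : f1 x = f1 y :=
    inv_injective (Equiv.ext fun a => Option.some.inj
      (DFunLike.congr_fun (PEquiv.toMatrix_injective h') a))
  exact MulAction.toPerm_injective (e.permCongrHom.injective h2)

theorem product_GL_universal_horn_theory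
    (F : Type*) [Field F] (d m : ℕ)
    (s : Fin m → FreeGroup (Fin d)) (t : FreeGroup (Fin d)) :
    (∀ (G : Type) [Group G] [Finite G] (g : Fin d → G),
      (∀ j, FreeGroup.lift g (s j) = 1) → FreeGroup.lift g t = 1) ↔
    (∀ g : Fin d → (∀ n : ℕ, GL (Fin n) F),
      (∀ j, FreeGroup.lift g (s j) = 1) → FreeGroup.lift g t = 1) := by
  constructor
  · intro H g hs
    funext n
    have key : ∀ w, FreeGroup.lift (fun i => g i n) w = FreeGroup.lift g w n := fun w =>
      lift_comp_aux (Pi.evalMonoidHom (fun n : ℕ => GL (Fin n) F) n) g w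
    obtain ⟨A, hA, g', hg'⟩ := exists_lift_aux d n (fun i => g i n)
    have hval : Function.Injective
        (GeneralLinearGroup.map (n := Fin n) (A.val : A →+* F)) :=
      Units.map_injective (Matrix.map_injective Subtype.val_injective)
    have key2 : ∀ w, FreeGroup.lift g w n =
        GeneralLinearGroup.map (n := Fin n) (A.val : A →+* F) (FreeGroup.lift g' w) := by
      intro w
      rw [← key, ← lift_comp_aux]
      simp only [hg']
    rw [key2, Pi.one_apply]
    have hs' : ∀ j, FreeGroup.lift g' (s j) = 1 := by
      intro j
      apply hval
      rw [← key2, hs, map_one, Pi.one_apply]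
    suffices h : FreeGroup.lift g' t = 1 by rw [h, map_one]
    by_contra hne
    have : ∃ a b, (FreeGroup.lift g' t).val a b - (1 : Matrix (Fin n) (Fin n) A) a b ≠ 0 := by
      by_contra! hcon
      exact hne (GeneralLinearGroup.ext fun a b => sub_eq_zero.mp (hcon a b))
    obtain ⟨a, b, hab⟩ := this
    obtain ⟨P, -, hfin, haP⟩ := exists_maximal_aux A _ hab
    let q := GeneralLinearGroup.map (n := Fin n) (Ideal.Quotient.mk P)
    have : Finite (GL (Fin n) (A ⧸ P)) := inferInstance
    let sh : GL (Fin n) (A ⧸ P) ≃* Shrink.{0} (GL (Fin n) (A ⧸ P)) := Shrink.mulEquiv.symm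
    have : Finite (Shrink.{0} (GL (Fin n) (A ⧸ P))) := Finite.of_equiv _ sh.toEquiv
    have h1 := H (Shrink.{0} (GL (Fin n) (A ⧸ P)))
      (fun i => (sh.toMonoidHom.comp q) (g' i)) (by
        intro j
        rw [lift_comp_aux, hs', map_one])
    rw [lift_comp_aux] at h1
    have h2 : q (FreeGroup.lift g' t) = 1 := by
      apply sh.injective
      rw [map_one]; exact h1
    apply haP
    rw [← Ideal.Quotient.eq]
    have h3 := congrArg (fun M => (Units.val M) a b) h2
    have h4 : (Ideal.Quotient.mk P) ((1 : Matrix (Fin n) (Fin n) A) a b) =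
        (1 : Matrix (Fin n) (Fin n) (A ⧸ P)) a b := by
      simp only [Matrix.one_apply]; split_ifs <;> simp
    rw [h4]
    exact h3
  · intro H G _ _ g hs
    obtain ⟨n, f, hf⟩ := exists_embed_aux F G
    let f' : G →* (∀ n : ℕ, GL (Fin n) F) := (MonoidHom.mulSingle _ n).comp f
    have hf' : Function.Injective f' := (Pi.mulSingle_injective n).comp hf
    apply hf'
    rw [← lift_comp_aux, map_one]
    apply H
    intro j
    rw [lift_comp_aux, hs, map_one]
end
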